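/- arXiv:math/0304368 — 2 statements merged into one kernel-verified Lean document; each statement's English description precedes it below -/
import Mathlib

section
/- (Jacobi–Trudi / dual Jacobi–Trudi identity) For a partition λ with λ_1 ≤ n and conjugate partition λ', the Schur polynomial satisfies s_λ(a) = det( e_{λ'_i − i + j}(a) )_{1≤i,j≤n}, where e_k denotes the elementary symmetric polynomial (e_k = 0 for k < 0). -/
/-- The `k`-th elementary symmetric polynomial of `a : Fin M → ℂ`, extended by `0`
for `k < 0`. -/
noncomputable def esymmInt {M : ℕ} (a : Fin M → ℂ) (k : ℤ) : ℂ :=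
  if 0 ≤ k then ∑ s ∈ Finset.univ.powersetCard k.toNat, ∏ i ∈ s, a i else 0

/-- The Schur polynomial `s_μ(a)` in `M` variables, defined combinatorially:
the sum over all semistandard Young tableaux `T` of shape `μ` with entries in
`{0, 1, …, M-1}` of the monomial `∏_i a_i ^ (number of entries of T equal to i)`. -/
noncomputable def schurComb {M : ℕ} (a : Fin M → ℂ) (μ : YoungDiagram) : ℂ :=
  ∑' T : {T : SemistandardYoungTableau μ // ∀ i j, (i, j) ∈ μ → T.entry i j < M},
    ∏ i : Fin M,
      a i ^ (μ.cells.filter fun c => (T : SemistandardYoungTableau μ).entry c.1 c.2 = i).card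

/-- The `k`-th elementary symmetric polynomial of `a 0, …, a (M - 1)`, extended by `0`
for `k < 0`. -/
def rangeEsymm {R : Type*} [CommRing R] (a : ℕ → R) (M : ℕ) (k : ℤ) : R :=
  if 0 ≤ k then ∑ s ∈ (Finset.range M).powersetCard k.toNat, ∏ i ∈ s, a i else 0

theorem rangeEsymm_of_neg {R : Type*} [CommRing R] (a : ℕ → R) (M : ℕ) {k : ℤ} (hk : k < 0) :
    rangeEsymm a M k = 0 :=
  if_neg (not_le.mpr hk)

theorem rangeEsymm_zero {R : Type*} [CommRing R] (a : ℕ → R) (k : ℤ) :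
    rangeEsymm a 0 k = if k = 0 then 1 else 0 := by
  rcases lt_trichotomy k 0 with hk | rfl | hk
  · rw [rangeEsymm_of_neg a 0 hk, if_neg hk.ne]
  · simp [rangeEsymm]
  · rw [rangeEsymm, if_pos hk.le, if_neg hk.ne', Finset.powersetCard_eq_empty.mpr]
    · simp
    · simp only [Finset.range_zero, Finset.card_empty]
      omega

theorem rangeEsymm_succ {R : Type*} [CommRing R] (a : ℕ → R) (M : ℕ) (k : ℤ) :
    rangeEsymm a (M + 1) k = rangeEsymm a M k + a M * rangeEsymm a M (k - 1) := by
  rcases lt_trichotomy k 0 with hk | rfl | hk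
  · simp [rangeEsymm_of_neg _ _ hk, rangeEsymm_of_neg a M (show k - 1 < 0 by omega)]
  · simp [rangeEsymm]
  · obtain ⟨m, rfl⟩ : ∃ m : ℕ, k = m + 1 := ⟨(k - 1).toNat, by omega⟩
    have hM : M ∉ Finset.range M := Finset.notMem_range_self
    have hs : ∀ s ∈ (Finset.range M).powersetCard m, M ∉ s := fun s hs h =>
      hM ((Finset.mem_powersetCard.mp hs).1 h)
    have h1 : ((m : ℤ) + 1).toNat = m + 1 := by omega
    have h2 : ((m : ℤ) + 1 - 1).toNat = m := by omega
    rw [rangeEsymm, rangeEsymm, rangeEsymm, if_pos hk.le, if_pos hk.le, if_pos (by omega), h1, h2,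
      Finset.range_add_one, Finset.powersetCard_succ_insert hM, Finset.sum_union, Finset.mul_sum,
      Finset.sum_image]
    · congr 1
      exact Finset.sum_congr rfl fun s h => Finset.prod_insert (hs s h)
    · intro s h t h' hst
      rw [← Finset.erase_insert (hs s h), ← Finset.erase_insert (hs t h'), hst]
    · rw [Finset.disjoint_left]
      intro s h h'
      obtain ⟨t, -, rfl⟩ := Finset.mem_image.mp h'
      exact hM ((Finset.mem_powersetCard.mp h).1 (Finset.mem_insert_self _ _))

/-- The dual Jacobi–Trudi determinant attached to a sequence of column lengths `c`. -/
def dualJacobiTrudi {R : Type*} [CommRing R] (a : ℕ → R) (M n : ℕ) (c : ℕ → ℤ) : R :=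
  Matrix.det fun i j : Fin n => rangeEsymm a M (c i - i + j)

/-- Decrease by one the entries of `c` whose index lies in `S`. -/
def decreaseOn {n : ℕ} (c : ℕ → ℤ) (S : Finset (Fin n)) (j : ℕ) : ℤ :=
  c j - if ∃ h : j < n, (⟨j, h⟩ : Fin n) ∈ S then 1 else 0

theorem decreaseOn_coe {n : ℕ} (c : ℕ → ℤ) (S : Finset (Fin n)) (i : Fin n) :
    decreaseOn c S i = c i - if i ∈ S then 1 else 0 := by
  simp [decreaseOn]

theorem dualJacobiTrudi_zero {R : Type*} [CommRing R] (a : ℕ → R) {n : ℕ} {c : ℕ → ℤ}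
    (hc : ∀ j, c j = 0) : dualJacobiTrudi a 0 n c = 1 := by
  rw [dualJacobiTrudi, ← Matrix.det_one (n := Fin n)]
  congr 1
  ext i j
  rw [rangeEsymm_zero, hc, Matrix.one_apply]
  exact if_congr (by rw [Fin.ext_iff]; omega) rfl rfl

theorem dualJacobiTrudi_zero_of_pos {R : Type*} [CommRing R] (a : ℕ → R) {n : ℕ} {c : ℕ → ℤ}
    (hn : 0 < n) (hc : 0 < c 0) : dualJacobiTrudi a 0 n c = 0 := by
  refine Matrix.det_eq_zero_of_row_eq_zero ⟨0, hn⟩ fun j => ?_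
  rw [rangeEsymm_zero, if_neg]
  simp only [Nat.cast_zero]
  omega

theorem dualJacobiTrudi_succ {R : Type*} [CommRing R] (a : ℕ → R) (M n : ℕ) (c : ℕ → ℤ) :
    dualJacobiTrudi a (M + 1) n c =
      ∑ S : Finset (Fin n), a M ^ S.card * dualJacobiTrudi a M n (decreaseOn c S) := by
  have h : (fun i j : Fin n => rangeEsymm a (M + 1) (c i - i + j)) =
      (fun i j : Fin n => a M * rangeEsymm a M (c i - 1 - i + j)) +
        fun i j : Fin n => rangeEsymm a M (c i - i + j) := by
    ext i j
    rw [rangeEsymm_succ, Pi.add_apply, Pi.add_apply, add_comm]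
    congr 3
    ring
  rw [dualJacobiTrudi, h]
  refine ((Matrix.detRowAlternating (R := R) (n := Fin n)).toMultilinearMap.map_add_univ
    _ _).trans (Finset.sum_congr rfl fun S _ => ?_)
  have h' : S.piecewise (fun i j : Fin n => a M * rangeEsymm a M (c i - 1 - i + j))
      (fun i j : Fin n => rangeEsymm a M (c i - i + j)) =
      fun i j : Fin n => (if i ∈ S then a M else 1) *
        rangeEsymm a M (decreaseOn c S i - i + j) := by
    ext i j
    rw [decreaseOn_coe]
    by_cases hi : i ∈ S <;> simp [hi]
  rw [h']
  refine (Matrix.det_mul_column _ _).trans ?_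
  rw [Finset.prod_ite_mem, Finset.univ_inter, Finset.prod_const]
  rfl

theorem dualJacobiTrudi_decreaseOn_eq_zero {R : Type*} [CommRing R] (a : ℕ → R) (M : ℕ) {n : ℕ}
    {c : ℕ → ℤ} (hc : Antitone c) (hn : ∀ j, n ≤ j → c j = 0) {S : Finset (Fin n)}
    (hS : ¬ Antitone (decreaseOn c S)) : dualJacobiTrudi a M n (decreaseOn c S) = 0 := by
  obtain ⟨i, hi⟩ : ∃ i, decreaseOn c S i < decreaseOn c S (i + 1) := by
    contrapose! hS
    exact antitone_nat_of_succ_le hS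
  have hci := hc i.le_succ
  rcases lt_trichotomy (i + 1) n with h | h | h
  · refine Matrix.det_zero_of_row_eq (i := ⟨i, by omega⟩) (j := ⟨i + 1, h⟩) (by simp) ?_
    funext j
    simp only [decreaseOn, Nat.succ_eq_add_one] at hi hci ⊢
    congr 1
    push_cast
    split_ifs at hi ⊢ <;> omega
  · have h0 := hn (i + 1) h.ge
    refine Matrix.det_eq_zero_of_row_eq_zero ⟨i, by omega⟩ fun j => rangeEsymm_of_neg _ _ ?_
    simp only [decreaseOn, Nat.succ_eq_add_one] at hi hci ⊢
    have := j.isLt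
    split_ifs at hi ⊢ <;> omega
  · have h0 := hn i (by omega)
    have h1 := hn (i + 1) (by omega)
    simp [decreaseOn, h0, h1, show ¬ i < n by omega, show ¬ i + 1 < n by omega] at hi

namespace SemistandardYoungTableau

/-- Semistandard Young tableaux of shape `μ` with entries less than `M`. -/
abbrev Bounded (M : ℕ) (μ : YoungDiagram) : Type :=
  {T : SemistandardYoungTableau μ // ∀ i j, (i, j) ∈ μ → T.entry i j < M}

theorem Bounded.ext_of_mem {M : ℕ} {μ : YoungDiagram} {T T' : Bounded M μ}
    (h : ∀ i j, (i, j) ∈ μ → T.1 i j = T'.1 i j) : T = T' := by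
  refine Subtype.ext (SemistandardYoungTableau.ext fun i j => ?_)
  by_cases hij : (i, j) ∈ μ
  · exact h i j hij
  · rw [T.1.zeros hij, T'.1.zeros hij]

instance (M : ℕ) (μ : YoungDiagram) : Finite (Bounded M μ) :=
  Finite.of_injective
    (fun T (c : μ.cells) =>
      (⟨T.1 c.1.1 c.1.2, T.2 _ _ ((YoungDiagram.mem_cells _).mp c.2)⟩ : Fin M))
    fun _ _ h => Bounded.ext_of_mem fun i j hij =>
      congrArg Fin.val (congrFun h ⟨(i, j), (YoungDiagram.mem_cells _).mpr hij⟩)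

noncomputable instance (M : ℕ) (μ : YoungDiagram) : Fintype (Bounded M μ) :=
  Fintype.ofFinite _

/-- The monomial attached to a tableau. -/
def weight {R : Type*} [CommRing R] (a : ℕ → R) {μ : YoungDiagram}
    (T : SemistandardYoungTableau μ) : R :=
  ∏ c ∈ μ.cells, a (T c.1 c.2)

open Classical in
/-- The columns, among the first `n`, which contain the entry `M`. -/
noncomputable def columnsWith (n M : ℕ) {μ : YoungDiagram} (T : SemistandardYoungTableau μ) :
    Finset (Fin n) :=
  Finset.univ.filter fun j => ∃ i, (i, (j : ℕ)) ∈ μ ∧ T i j = M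

theorem mem_columnsWith {n M : ℕ} {μ : YoungDiagram} {T : SemistandardYoungTableau μ}
    {j : Fin n} : j ∈ columnsWith n M T ↔ ∃ i, (i, (j : ℕ)) ∈ μ ∧ T i j = M := by
  simp [columnsWith]

/-- In a tableau with entries at most `M`, the entry `M` occurs only at the bottom of a column. -/
theorem Bounded.eq_iff {M n : ℕ} {μ : YoungDiagram} (T : Bounded (M + 1) μ) {i j : ℕ}
    (hj : j < n) (hij : (i, j) ∈ μ) :
    T.1 i j = M ↔ (⟨j, hj⟩ : Fin n) ∈ columnsWith n M T.1 ∧ i + 1 = μ.colLen j := by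
  have key : ∀ i, (i, j) ∈ μ → T.1 i j = M → i + 1 = μ.colLen j := by
    intro i hij h
    have h1 := YoungDiagram.mem_iff_lt_colLen.mp hij
    by_contra h2
    have h3 : (i + 1, j) ∈ μ := YoungDiagram.mem_iff_lt_colLen.mpr (by omega)
    have h4 := T.1.col_strict (Nat.lt_add_one i) h3
    have h5 : T.1 (i + 1) j < M + 1 := T.2 _ _ h3
    omega
  constructor
  · exact fun h => ⟨mem_columnsWith.mpr ⟨i, hij, h⟩, key i hij h⟩
  · rintro ⟨h, h'⟩
    obtain ⟨k, hk, hk'⟩ := mem_columnsWith.mp h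
    have := key k hk hk'
    obtain rfl : i = k := by omega
    exact hk'

theorem Bounded.antitone_decreaseOn {M n : ℕ} {μ : YoungDiagram} (hn : μ.rowLen 0 ≤ n)
    (T : Bounded (M + 1) μ) :
    Antitone (decreaseOn (fun j => (μ.colLen j : ℤ)) (columnsWith n M T.1)) := by
  refine antitone_nat_of_succ_le fun j => ?_
  have hc := μ.colLen_anti j (j + 1) j.le_succ
  by_contra hlt
  simp only [decreaseOn] at hlt
  have h1 : ∃ h : j < n, (⟨j, h⟩ : Fin n) ∈ columnsWith n M T.1 := by
    by_contra h
    rw [if_neg h] at hlt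
    split_ifs at hlt <;> omega
  rw [if_pos h1] at hlt
  have h2 : ¬ ∃ h : j + 1 < n, (⟨j + 1, h⟩ : Fin n) ∈ columnsWith n M T.1 := by
    intro h
    rw [if_pos h] at hlt
    omega
  rw [if_neg h2] at hlt
  obtain ⟨hj, hS⟩ := h1
  obtain ⟨i, hi, hiM⟩ := mem_columnsWith.mp hS
  have h3 := ((T.eq_iff hj hi).mp hiM).2
  have h4 : (i, j + 1) ∈ μ := YoungDiagram.mem_iff_lt_colLen.mpr (by omega)
  have h5 : j + 1 < n := by
    have := YoungDiagram.mem_iff_lt_rowLen.mp (μ.up_left_mem (Nat.zero_le i) le_rfl h4)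
    omega
  have h6 := T.1.row_weak (Nat.lt_add_one j) h4
  have h7 : T.1 i (j + 1) < M + 1 := T.2 _ _ h4
  exact h2 ⟨h5, mem_columnsWith.mpr
    ⟨i, h4, (Nat.lt_succ_iff.mp h7).antisymm (hiM.symm.le.trans h6)⟩⟩

section Strip

variable {μ ν : YoungDiagram} {n : ℕ} {S : Finset (Fin n)}

/-- The diagram `ν` is obtained from `μ` by removing the bottom cell of each column in `S`. -/
def IsStrip (μ ν : YoungDiagram) (S : Finset (Fin n)) : Prop :=
  ∀ j, (ν.colLen j : ℤ) = decreaseOn (fun j => (μ.colLen j : ℤ)) S j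

theorem exists_isStrip
    (hS : Antitone (decreaseOn (fun j => (μ.colLen j : ℤ)) S)) :
    ∃ ν : YoungDiagram, IsStrip μ ν S := by
  set d := decreaseOn (fun j => (μ.colLen j : ℤ)) S with hd
  have hle : ∀ j, d j ≤ μ.colLen j := by
    intro j
    simp only [hd, decreaseOn]
    split_ifs <;> omega
  have h0 : ∀ j, 0 ≤ d j := by
    intro j
    refine le_trans ?_ (hS (le_max_left j n))
    simp only [hd, decreaseOn]
    rw [if_neg]
    · omega
    · rintro ⟨h, -⟩
      omega
  have hlower : IsLowerSet (↑(μ.cells.filter fun c => (c.1 : ℤ) < d c.2) : Set (ℕ × ℕ)) := by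
    rintro ⟨i, j⟩ ⟨i', j'⟩ ⟨hi, hj⟩ h
    simp only [Finset.mem_coe, Finset.mem_filter, YoungDiagram.mem_cells] at h ⊢
    exact ⟨μ.up_left_mem hi hj h.1, (Int.ofNat_le.mpr hi).trans_lt (h.2.trans_le (hS hj))⟩
  refine ⟨⟨_, hlower⟩, fun j => ?_⟩
  rw [YoungDiagram.colLen_eq_card, ← hd]
  have : (YoungDiagram.col ⟨μ.cells.filter fun c => (c.1 : ℤ) < d c.2, hlower⟩ j) =
      Finset.range (d j).toNat ×ˢ {j} := by
    ext ⟨i, k⟩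
    have := hle k
    have := h0 k
    simp only [YoungDiagram.mem_col_iff, YoungDiagram.mem_mk, Finset.mem_filter,
      YoungDiagram.mem_cells, Finset.mem_product, Finset.mem_range, Finset.mem_singleton]
    rw [YoungDiagram.mem_iff_lt_colLen]
    constructor
    · rintro ⟨⟨-, h⟩, rfl⟩
      exact ⟨by omega, rfl⟩
    · rintro ⟨h, rfl⟩
      exact ⟨⟨by omega, by omega⟩, rfl⟩
  rw [this, Finset.card_product, Finset.card_range, Finset.card_singleton]
  have := h0 j
  omega

theorem IsStrip.mem_iff (h : IsStrip μ ν S) {i j : ℕ} :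
    (i, j) ∈ ν ↔ (i, j) ∈ μ ∧
      ¬ ((∃ hj : j < n, (⟨j, hj⟩ : Fin n) ∈ S) ∧ i + 1 = μ.colLen j) := by
  have := h j
  simp only [decreaseOn] at this
  rw [YoungDiagram.mem_iff_lt_colLen, YoungDiagram.mem_iff_lt_colLen]
  by_cases hS : ∃ hj : j < n, (⟨j, hj⟩ : Fin n) ∈ S
  · simp only [hS, true_and, if_true] at this ⊢
    omega
  · simp only [hS, false_and, not_false_iff, and_true, if_false] at this ⊢
    omega

theorem IsStrip.le (h : IsStrip μ ν S) : ν ≤ μ :=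
  fun _ hc => (h.mem_iff.mp hc).1

theorem IsStrip.colLen_pos (h : IsStrip μ ν S) {j : Fin n} (hj : j ∈ S) : 0 < μ.colLen j := by
  have := h j
  rw [decreaseOn_coe, if_pos hj] at this
  omega

theorem IsStrip.card_sdiff (h : IsStrip μ ν S) : (μ.cells \ ν.cells).card = S.card := by
  symm
  refine Finset.card_bij (fun j _ => (μ.colLen j - 1, (j : ℕ))) ?_ ?_ ?_
  · intro j hj
    have := h.colLen_pos hj
    rw [Finset.mem_sdiff, YoungDiagram.mem_cells, YoungDiagram.mem_cells, h.mem_iff]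
    have hm : (μ.colLen j - 1, (j : ℕ)) ∈ μ := YoungDiagram.mem_iff_lt_colLen.mpr (by omega)
    exact ⟨hm, fun h' => h'.2 ⟨⟨j.2, hj⟩, by omega⟩⟩
  · intro j _ k _ hjk
    exact Fin.ext (Prod.ext_iff.mp hjk).2
  · rintro ⟨i, j⟩ hij
    rw [Finset.mem_sdiff, YoungDiagram.mem_cells, YoungDiagram.mem_cells, h.mem_iff] at hij
    obtain ⟨⟨hj, hS⟩, h'⟩ := not_not.mp fun h' => hij.2 ⟨hij.1, h'⟩
    exact ⟨⟨j, hj⟩, hS, by simp [← h']⟩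

open Classical in
/-- Fill the cells of `μ` outside `ν` with the entry `M`. -/
noncomputable def Bounded.extend {M : ℕ} (h : IsStrip μ ν S) (T : Bounded M ν) :
    Bounded (M + 1) μ where
  val :=
    { entry := fun i j => if (i, j) ∈ ν then T.1 i j else if (i, j) ∈ μ then M else 0
      row_weak' := by
        intro i j k hjk hk
        by_cases h1 : (i, k) ∈ ν
        · have h2 := ν.up_left_mem le_rfl hjk.le h1
          rw [if_pos h1, if_pos h2]
          exact T.1.row_weak hjk h1
        · rw [if_neg h1, if_pos hk]
          split_ifs with h2
          · exact (T.2 _ _ h2).le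
          · exact le_rfl
          · exact Nat.zero_le _
      col_strict' := by
        intro i k j hik hk
        have h2 : (i, j) ∈ ν := by
          rw [h.mem_iff]
          refine ⟨μ.up_left_mem hik.le le_rfl hk, fun h' => ?_⟩
          have := YoungDiagram.mem_iff_lt_colLen.mp hk
          omega
        rw [if_pos h2]
        by_cases h1 : (k, j) ∈ ν
        · rw [if_pos h1]
          exact T.1.col_strict hik h1
        · rw [if_neg h1, if_pos hk]
          exact T.2 _ _ h2
      zeros' := fun hij => by rw [if_neg fun h' => hij (h.le h'), if_neg hij] }
  property := fun i j hij => by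
    change (if (i, j) ∈ ν then T.1 i j else if (i, j) ∈ μ then M else 0) < M + 1
    split_ifs with h1
    · exact (T.2 _ _ h1).trans M.lt_succ_self
    · exact M.lt_succ_self

theorem Bounded.extend_apply_of_mem {M : ℕ} (h : IsStrip μ ν S) (T : Bounded M ν) {i j : ℕ}
    (hij : (i, j) ∈ ν) : (T.extend h).1 i j = T.1 i j :=
  if_pos hij

theorem Bounded.extend_apply_of_notMem {M : ℕ} (h : IsStrip μ ν S) (T : Bounded M ν) {i j : ℕ}
    (hij : (i, j) ∈ μ) (hij' : (i, j) ∉ ν) : (T.extend h).1 i j = M :=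
  (if_neg hij').trans (if_pos hij)

theorem Bounded.extend_injective {M : ℕ} (h : IsStrip μ ν S) :
    Function.Injective (Bounded.extend (M := M) h) := by
  intro T T' hT
  refine Bounded.ext_of_mem fun i j hij => ?_
  rw [← T.extend_apply_of_mem h hij, hT, T'.extend_apply_of_mem h hij]

theorem Bounded.columnsWith_extend {M : ℕ} (h : IsStrip μ ν S) (T : Bounded M ν) :
    columnsWith n M (T.extend h).1 = S := by
  ext j
  rw [mem_columnsWith]
  constructor
  · rintro ⟨i, hi, hiM⟩
    by_contra hj
    have hν : (i, (j : ℕ)) ∈ ν := h.mem_iff.mpr ⟨hi, fun h' => hj h'.1.2⟩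
    rw [T.extend_apply_of_mem h hν] at hiM
    exact (T.2 _ _ hν).ne hiM
  · intro hj
    have h0 := h.colLen_pos hj
    have hm : (μ.colLen j - 1, (j : ℕ)) ∈ μ := YoungDiagram.mem_iff_lt_colLen.mpr (by omega)
    exact ⟨_, hm, T.extend_apply_of_notMem h hm fun h' =>
      (h.mem_iff.mp h').2 ⟨⟨j.2, hj⟩, by omega⟩⟩

theorem Bounded.exists_extend_eq {M : ℕ} (hn : μ.rowLen 0 ≤ n) (h : IsStrip μ ν S)
    (T : Bounded (M + 1) μ) (hT : columnsWith n M T.1 = S) :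
    ∃ T' : Bounded M ν, T'.extend h = T := by
  classical
  have hlt : ∀ {i j}, (i, j) ∈ μ → j < n := fun hij =>
    (YoungDiagram.mem_iff_lt_rowLen.mp (μ.up_left_mem (Nat.zero_le _) le_rfl hij)).trans_le hn
  have key : ∀ {i j}, (i, j) ∈ μ → ((i, j) ∈ ν ↔ T.1 i j ≠ M) := by
    intro i j hij
    rw [h.mem_iff, Ne, T.eq_iff (hlt hij) hij, hT]
    simp [hij, hlt hij]
  refine ⟨⟨⟨fun i j => if (i, j) ∈ ν then T.1 i j else 0, ?_, ?_, fun hij => if_neg hij⟩, ?_⟩, ?_⟩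
  · intro i j k hjk hk
    rw [if_pos hk, if_pos (ν.up_left_mem le_rfl hjk.le hk)]
    exact T.1.row_weak hjk (h.le hk)
  · intro i k j hik hk
    rw [if_pos hk, if_pos (ν.up_left_mem hik.le le_rfl hk)]
    exact T.1.col_strict hik (h.le hk)
  · intro i j hij
    change (if (i, j) ∈ ν then T.1 i j else 0) < M
    rw [if_pos hij]
    exact lt_of_le_of_ne (Nat.lt_succ_iff.mp (T.2 _ _ (h.le hij))) ((key (h.le hij)).mp hij)
  · refine Bounded.ext_of_mem fun i j hij => ?_
    by_cases hν : (i, j) ∈ ν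
    · rw [Bounded.extend_apply_of_mem h _ hν]
      exact if_pos hν
    · rw [Bounded.extend_apply_of_notMem h _ hij hν]
      exact (not_not.mp fun h' => hν ((key hij).mpr h')).symm

theorem Bounded.weight_extend {R : Type*} [CommRing R] (a : ℕ → R) {M : ℕ} (h : IsStrip μ ν S)
    (T : Bounded M ν) : weight a (T.extend h).1 = a M ^ S.card * weight a T.1 := by
  rw [weight, weight, ← Finset.prod_sdiff (YoungDiagram.cells_subset_iff.mpr h.le),
    ← h.card_sdiff, ← Finset.prod_const]
  congr 1
  · refine Finset.prod_congr rfl fun c hc => ?_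
    rw [Finset.mem_sdiff] at hc
    rw [T.extend_apply_of_notMem h hc.1 hc.2]
  · refine Finset.prod_congr rfl fun c hc => ?_
    rw [T.extend_apply_of_mem h hc]

end Strip

theorem sum_weight_eq_dualJacobiTrudi {R : Type*} [CommRing R] (a : ℕ → R) (M n : ℕ)
    (μ : YoungDiagram) (hn : μ.rowLen 0 ≤ n) :
    ∑ T : Bounded M μ, weight a T.1 = dualJacobiTrudi a M n fun j => (μ.colLen j : ℤ) := by
  classical
  induction M generalizing μ with
  | zero =>
    by_cases hμ : (0, 0) ∈ μ
    · have : IsEmpty (Bounded 0 μ) := ⟨fun T => absurd (T.2 _ _ hμ) (Nat.not_lt_zero _)⟩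
      rw [dualJacobiTrudi_zero_of_pos, Finset.univ_eq_empty, Finset.sum_empty]
      · exact (Nat.zero_le _).trans_lt
          ((YoungDiagram.mem_iff_lt_rowLen.mp hμ).trans_le hn)
      · exact Int.natCast_pos.mpr (YoungDiagram.mem_iff_lt_colLen.mp hμ)
    · have hμ' : ∀ i j, (i, j) ∉ μ := fun i j h =>
        hμ (μ.up_left_mem (Nat.zero_le i) (Nat.zero_le j) h)
      have hcells : μ.cells = ∅ :=
        Finset.eq_empty_of_forall_notMem fun c hc => hμ' _ _ ((YoungDiagram.mem_cells c).mp hc)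
      rw [dualJacobiTrudi_zero]
      · have : Unique (Bounded 0 μ) :=
          { default := ⟨default, fun i j h => absurd h (hμ' i j)⟩
            uniq := fun T => Bounded.ext_of_mem fun i j h => absurd h (hμ' i j) }
        rw [Fintype.sum_unique, weight, hcells, Finset.prod_empty]
      · intro j
        rw [Int.natCast_eq_zero]
        by_contra h
        exact hμ' 0 j (YoungDiagram.mem_iff_lt_colLen.mpr (Nat.pos_of_ne_zero h))
  | succ M ih =>
    rw [dualJacobiTrudi_succ, ← Finset.sum_fiberwise Finset.univ
      fun T : Bounded (M + 1) μ => columnsWith n M T.1]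
    refine Finset.sum_congr rfl fun S _ => ?_
    by_cases hS : Antitone (decreaseOn (fun j => (μ.colLen j : ℤ)) S)
    · obtain ⟨ν, hν⟩ := exists_isStrip hS
      have hνn : ν.rowLen 0 ≤ n := by
        by_contra! hlt
        have := YoungDiagram.mem_iff_lt_rowLen.mp (hν.le (YoungDiagram.mem_iff_lt_rowLen.mpr hlt))
        omega
      rw [← funext hν, ← ih ν hνn, Finset.mul_sum]
      symm
      refine Finset.sum_bij (fun T _ => T.extend hν) ?_ ?_ ?_ ?_
      · exact fun T _ => by simpa using T.columnsWith_extend hν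
      · exact fun T _ T' _ hT => Bounded.extend_injective hν hT
      · intro T hT
        obtain ⟨T', hT'⟩ := T.exists_extend_eq hn hν (Finset.mem_filter.mp hT).2
        exact ⟨T', Finset.mem_univ _, hT'⟩
      · exact fun T _ => (T.weight_extend a hν).symm
    · rw [dualJacobiTrudi_decreaseOn_eq_zero a M _ _ hS, mul_zero]
      · refine Finset.sum_eq_zero fun T hT => absurd ?_ hS
        rw [← (Finset.mem_filter.mp hT).2]
        exact T.antitone_decreaseOn hn
      · exact fun i j hij => Int.ofNat_le.mpr (μ.colLen_anti i j hij)
      · intro j hj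
        rw [Int.natCast_eq_zero]
        by_contra h
        have := YoungDiagram.mem_iff_lt_rowLen.mp
          (YoungDiagram.mem_iff_lt_colLen.mpr (Nat.pos_of_ne_zero h))
        omega

end SemistandardYoungTableau

theorem esymmInt_comp_val {M : ℕ} (a : ℕ → ℂ) (k : ℤ) :
    esymmInt (fun i : Fin M => a i) k = rangeEsymm a M k := by
  rw [esymmInt, rangeEsymm]
  refine if_congr Iff.rfl ?_ rfl
  have h : Finset.range M = Finset.univ.map (Fin.valEmbedding (n := M)) := by
    ext i
    simp
  rw [h, Finset.powersetCard_map, Finset.sum_map]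
  exact Finset.sum_congr rfl fun s _ => by simp

theorem schurComb_comp_val {M : ℕ} (a : ℕ → ℂ) (μ : YoungDiagram) :
    schurComb (fun i : Fin M => a i) μ =
      ∑ T : SemistandardYoungTableau.Bounded M μ, SemistandardYoungTableau.weight a T.1 := by
  rw [schurComb, tsum_fintype]
  refine Finset.sum_congr rfl fun T _ => ?_
  rw [SemistandardYoungTableau.weight, ← Finset.prod_fiberwise_of_maps_to
    (t := Finset.range M) (g := fun c => T.1 c.1 c.2)
    (fun c hc => Finset.mem_range.mpr (T.2 _ _ ((YoungDiagram.mem_cells c).mp hc))),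
    Finset.prod_range]
  refine Finset.prod_congr rfl fun i _ => ?_
  rw [← Finset.prod_const]
  refine Finset.prod_congr rfl fun c hc => ?_
  exact congrArg a (Finset.mem_filter.mp hc).2.symm

/-- The (dual) Jacobi–Trudi identity: for a partition `μ` with `μ_1 ≤ n`,
`s_μ(a) = det(e_{μ'_i - i + j}(a))_{1 ≤ i,j ≤ n}`, where `μ'` is the conjugate
partition and `e_k = 0` for `k < 0`. -/
theorem jacobi_trudi {M : ℕ} (a : Fin M → ℂ) (μ : YoungDiagram) (n : ℕ)
    (hn : μ.rowLen 0 ≤ n) :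
    schurComb a μ =
      Matrix.det fun i j : Fin n =>
        esymmInt a ((μ.colLen i : ℤ) - (i : ℤ) + (j : ℤ)) := by
  obtain ⟨b, rfl⟩ : ∃ b : ℕ → ℂ, (fun i : Fin M => b i) = a :=
    ⟨fun i => if h : i < M then a ⟨i, h⟩ else 0, by simp⟩
  rw [schurComb_comp_val, SemistandardYoungTableau.sum_weight_eq_dualJacobiTrudi b M n μ hn]
  simp only [esymmInt_comp_val]
  rfl
end

section
/- (Gessel's formula, Poissonized version) For every n ≥ 1 and α > 0, Σ_{N=0}^∞ (e^{−α} α^N / N!) · F(N,n) = e^{−α} D_n(e^{2√α cos θ}), where F(N,n) is the fraction of permutations in S_N whose longest increasing subsequence has length ≤ n, and D_n(e^{2√α cos θ}) is the n×n Toeplitz determinant with symbol exp(√α(z + z^{−1})). -/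
open MeasureTheory Real

/-- The length of the longest increasing subsequence of a permutation `σ` of `Fin N`. -/
noncomputable def lisLen {N : ℕ} (σ : Equiv.Perm (Fin N)) : ℕ :=
  sSup {m : ℕ | ∃ f : Fin m → Fin N, StrictMono f ∧ StrictMono (σ ∘ f)}

/-- The fraction of permutations of `{1, …, N}` whose longest increasing subsequence
has length at most `n`. -/
noncomputable def lisFrac (N n : ℕ) : ℝ :=
  ((Finset.univ.filter fun σ : Equiv.Perm (Fin N) => lisLen σ ≤ n).card : ℝ) /
    Nat.factorial N

/-- `μ` is obtained from `ν` by adding one box. -/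
def YoungDiagram.AddsBox (ν μ : YoungDiagram) : Prop :=
  ∃ c ∉ ν.cells, μ.cells = insert c ν.cells

namespace YoungDiagram

theorem ext_rowLen {μ ν : YoungDiagram} (h : ∀ i, μ.rowLen i = ν.rowLen i) : μ = ν := by
  ext ⟨i, j⟩
  rw [mem_cells, mem_cells, mem_iff_lt_rowLen, mem_iff_lt_rowLen, h]

theorem rowLen_bot (i : ℕ) : (⊥ : YoungDiagram).rowLen i = 0 := by
  by_contra h
  exact notMem_bot (i, 0) (mem_iff_lt_rowLen.2 (Nat.pos_of_ne_zero h))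

theorem addsBox_iff_rowLen {ν μ : YoungDiagram} :
    ν.AddsBox μ ↔ ∃ i, ∀ k, μ.rowLen k = ν.rowLen k + if k = i then 1 else 0 := by
  constructor
  · rintro ⟨⟨i, j⟩, hc, h⟩
    have key : ∀ k l, l < μ.rowLen k ↔ (k = i ∧ l = j) ∨ l < ν.rowLen k := by
      intro k l
      rw [← mem_iff_lt_rowLen, ← mem_iff_lt_rowLen, ← mem_cells, ← mem_cells, h]
      simp
    rw [mem_cells, mem_iff_lt_rowLen] at hc
    refine ⟨i, fun k => ?_⟩
    split_ifs with hk
    · subst hk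
      have h1 := key k j
      have h2 := key k (ν.rowLen k)
      have h3 := key k (ν.rowLen k + 1)
      have h4 := key k (j + 1)
      omega
    · have h1 := key k (μ.rowLen k)
      have h2 := key k (ν.rowLen k)
      omega
  · rintro ⟨i, h⟩
    refine ⟨(i, ν.rowLen i), by simp [mem_iff_lt_rowLen], ?_⟩
    ext ⟨k, l⟩
    rw [Finset.mem_insert, mem_cells, mem_cells, mem_iff_lt_rowLen, mem_iff_lt_rowLen, h,
      Prod.mk.injEq]
    split_ifs with hk
    · subst hk; omega
    · omega

theorem AddsBox.card_eq {ν μ : YoungDiagram} (h : ν.AddsBox μ) : μ.card = ν.card + 1 := by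
  obtain ⟨c, hc, h⟩ := h
  rw [YoungDiagram.card, h, Finset.card_insert_of_notMem hc]

theorem AddsBox.transpose {ν μ : YoungDiagram} (h : ν.AddsBox μ) :
    ν.transpose.AddsBox μ.transpose := by
  obtain ⟨c, hc, h⟩ := h
  refine ⟨c.swap, by simpa [mem_cells] using hc, ?_⟩
  ext x
  have := congrArg (x.swap ∈ ·) h
  simp only [mem_cells, Finset.mem_insert, eq_iff_iff] at this
  simp only [mem_cells, Finset.mem_insert, mem_transpose, this]
  rw [Prod.swap_eq_iff_eq_swap]

theorem card_transpose (μ : YoungDiagram) : μ.transpose.card = μ.card := by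
  simp [YoungDiagram.card, YoungDiagram.transpose]

theorem rowLen_le_card (μ : YoungDiagram) (i : ℕ) : μ.rowLen i ≤ μ.card := by
  rw [rowLen_eq_card]
  exact Finset.card_le_card (Finset.filter_subset _ _)

theorem colLen_le_card (μ : YoungDiagram) (i : ℕ) : μ.colLen i ≤ μ.card := by
  rw [colLen_eq_card]
  exact Finset.card_le_card (Finset.filter_subset _ _)

theorem finite_card_eq (N : ℕ) : {μ : YoungDiagram | μ.card = N}.Finite := by
  refine Set.Finite.of_finite_image (f := YoungDiagram.cells)
    (Set.Finite.subset (Finset.powerset (Finset.range N ×ˢ Finset.range N)).finite_toSet ?_) ?_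
  · rintro _ ⟨μ, rfl, rfl⟩
    rw [Finset.mem_coe, Finset.mem_powerset]
    rintro ⟨i, j⟩ h
    rw [Finset.mem_product, Finset.mem_range, Finset.mem_range]
    rw [mem_cells] at h
    exact ⟨(mem_iff_lt_colLen.1 h).trans_le (μ.colLen_le_card _),
      (mem_iff_lt_rowLen.1 h).trans_le (μ.rowLen_le_card _)⟩
  · intro μ _ ν _ h
    exact YoungDiagram.ext h

/-- The Young diagrams with `N` boxes. -/
noncomputable def ofCard (N : ℕ) : Finset YoungDiagram := (finite_card_eq N).toFinset

@[simp]
theorem mem_ofCard {N : ℕ} {μ : YoungDiagram} : μ ∈ ofCard N ↔ μ.card = N := by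
  simp [ofCard]

theorem eq_bot_of_card_eq_zero {μ : YoungDiagram} (h : μ.card = 0) : μ = ⊥ := by
  apply YoungDiagram.ext
  rw [cells_bot]
  exact Finset.card_eq_zero.1 h

open Classical in
/-- The sequences of Young diagrams starting at `⊥`, adding one box at each of the first `N` steps,
and then staying at `μ`. -/
noncomputable def chains : ℕ → YoungDiagram → Finset (ℕ → YoungDiagram)
  | 0, μ => if μ = ⊥ then {fun _ => ⊥} else ∅
  | N + 1, μ => ((ofCard N).filter (AddsBox · μ)).biUnion fun ν =>
      (chains N ν).image fun P t => if t ≤ N then P t else μ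

theorem mem_chains {N : ℕ} {μ : YoungDiagram} {P : ℕ → YoungDiagram} :
    P ∈ chains N μ ↔ P 0 = ⊥ ∧ (∀ t < N, (P t).AddsBox (P (t + 1))) ∧ ∀ t, N ≤ t → P t = μ := by
  induction N generalizing μ P with
  | zero =>
    rw [chains]
    split_ifs with h
    · subst h
      simp only [Finset.mem_singleton]
      constructor
      · rintro rfl; simp
      · rintro ⟨-, -, h⟩
        funext t
        exact h t t.zero_le
    · simp only [Finset.notMem_empty, false_iff, not_and]
      intro h0 _ h1
      exact h ((h1 0 le_rfl).symm.trans h0)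
  | succ N ih =>
    simp only [chains, Finset.mem_biUnion, Finset.mem_filter, mem_ofCard, Finset.mem_image]
    constructor
    · rintro ⟨ν, ⟨-, hν⟩, R, hR, rfl⟩
      obtain ⟨h0, h1, h2⟩ := ih.1 hR
      refine ⟨by simpa using h0, fun t ht => ?_, fun t ht => if_neg (by omega)⟩
      simp only
      rw [if_pos (by omega)]
      split_ifs with h
      · exact h1 t (by omega)
      · rw [h2 t (by omega)]; exact hν
    · rintro ⟨h0, h1, h2⟩
      have hcard : ∀ t ≤ N + 1, (P t).card = t := by
        intro t
        induction t with
        | zero => intro _; rw [h0]; rfl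
        | succ t iht => intro ht; rw [(h1 t (by omega)).card_eq, iht (by omega)]
      refine ⟨P N, ⟨hcard N (by omega), ?_⟩, fun t => P (min t N), ih.2 ⟨by simpa using h0, ?_, ?_⟩,
        ?_⟩
      · rw [← h2 (N + 1) le_rfl]; exact h1 N (by omega)
      · intro t ht
        rw [min_eq_left ht.le, min_eq_left ht]
        exact h1 t (by omega)
      · intro t ht
        rw [min_eq_right ht]
      · funext t
        split_ifs with h
        · exact congrArg P (min_eq_left h)
        · rw [h2 t (by omega)]

open Classical in
theorem card_chains_succ (N : ℕ) (μ : YoungDiagram) :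
    (chains (N + 1) μ).card =
      ∑ ν ∈ (ofCard N).filter (AddsBox · μ), (chains N ν).card := by
  rw [chains, Finset.card_biUnion]
  · refine Finset.sum_congr rfl fun ν _ => Finset.card_image_of_injOn ?_
    intro P hP Q hQ h
    have hP' := (mem_chains.1 hP).2.2
    have hQ' := (mem_chains.1 hQ).2.2
    funext t
    by_cases ht : t ≤ N
    · simpa [ht] using congrFun h t
    · rw [hP' t (by omega), hQ' t (by omega)]
  · intro ν _ ν' _ hne
    rw [Function.onFun, Finset.disjoint_left]
    intro R hR hR'
    obtain ⟨P, hP, rfl⟩ := Finset.mem_image.1 hR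
    obtain ⟨Q, hQ, h⟩ := Finset.mem_image.1 hR'
    apply hne
    have := congrFun h N
    simp only [le_refl, if_true] at this
    rw [← (mem_chains.1 hP).2.2 N le_rfl, ← (mem_chains.1 hQ).2.2 N le_rfl, this]

theorem transpose_bot : (⊥ : YoungDiagram).transpose = ⊥ := by
  ext x
  simp [mem_cells]

theorem card_chains_transpose (N : ℕ) (μ : YoungDiagram) :
    (chains N μ.transpose).card = (chains N μ).card := by
  induction N generalizing μ with
  | zero =>
    by_cases h : μ = ⊥
    · rw [h, transpose_bot]
    · have h' : μ.transpose ≠ ⊥ := by rwa [Ne, transpose_eq_iff_eq_transpose, transpose_bot]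
      rw [chains, chains, if_neg h, if_neg h']
  | succ N ih =>
    classical
    rw [card_chains_succ, card_chains_succ]
    refine Finset.sum_nbij' transpose transpose ?_ ?_ ?_ ?_ ?_
    · intro ν hν
      rw [Finset.mem_filter, mem_ofCard] at hν ⊢
      exact ⟨by rw [card_transpose, hν.1], by simpa using hν.2.transpose⟩
    · intro ν hν
      rw [Finset.mem_filter, mem_ofCard] at hν ⊢
      exact ⟨by rw [card_transpose, hν.1], hν.2.transpose⟩
    · simp
    · simp
    · intro ν _
      rw [← ih ν]

/-- The Young diagram whose `i`-th row has length `r i` for `i < K`, provided `r` is antitone. -/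
def ofRowFun (K : ℕ) (r : ℕ → ℕ) : YoungDiagram where
  cells := (Finset.range K ×ˢ Finset.range (r 0)).filter fun c => ∀ i ≤ c.1, c.2 < r i
  isLowerSet := by
    rintro ⟨a, b⟩ ⟨c, d⟩ h hab
    obtain ⟨h1, h2⟩ := Prod.mk_le_mk.1 h
    simp only [Finset.coe_filter, Finset.mem_product, Finset.mem_range, Set.mem_ofPred_eq] at hab ⊢
    exact ⟨⟨by omega, by omega⟩, fun i hi => h2.trans_lt (hab.2 i (by omega))⟩

theorem rowLen_ofRowFun {K : ℕ} {r : ℕ → ℕ} (hr : Antitone r) (hK : ∀ k, K ≤ k → r k = 0) (k : ℕ) :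
    (ofRowFun K r).rowLen k = r k := by
  have key : ∀ l, l < (ofRowFun K r).rowLen k ↔ l < r k := by
    intro l
    rw [← mem_iff_lt_rowLen, ← mem_cells]
    simp only [ofRowFun, Finset.mem_filter, Finset.mem_product, Finset.mem_range]
    constructor
    · rintro ⟨-, h⟩
      exact h k le_rfl
    · intro h
      refine ⟨⟨?_, h.trans_le (hr k.zero_le)⟩, fun i hi => h.trans_le (hr hi)⟩
      by_contra hk
      have := hK k (by omega)
      omega
  have h1 := key (r k)
  have h2 := key ((ofRowFun K r).rowLen k)
  omega

end YoungDiagram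

/-- The operator summing the values of a function on `ℤⁿ` over the points obtained by adding `c`
to one coordinate. -/
def stepSum (n : ℕ) (c : ℤ) : Module.End ℂ ((Fin n → ℤ) → ℂ) where
  toFun h y := ∑ i, h (y + Pi.single i c)
  map_add' f g := by funext y; simp [Finset.sum_add_distrib]
  map_smul' a f := by funext y; simp [Finset.mul_sum]

theorem stepSum_apply {n : ℕ} (c : ℤ) (h : (Fin n → ℤ) → ℂ) (y : Fin n → ℤ) :
    stepSum n c h y = ∑ i, h (y + Pi.single i c) := rfl

theorem stepSum_commute (n : ℕ) (c d : ℤ) : Commute (stepSum n c) (stepSum n d) := by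
  refine LinearMap.ext fun h => funext fun y => ?_
  simp only [Module.End.mul_apply, stepSum_apply]
  rw [Finset.sum_comm]
  simp only [add_right_comm]

/-- Functions on `ℤⁿ` that are alternating under permutations of the coordinates. -/
def IsAlternating {n : ℕ} (h : (Fin n → ℤ) → ℂ) : Prop :=
  ∀ (τ : Equiv.Perm (Fin n)) (y : Fin n → ℤ), h (y ∘ τ) = (Equiv.Perm.sign τ : ℤ) * h y

namespace IsAlternating

variable {n : ℕ} {h : (Fin n → ℤ) → ℂ}

theorem stepSum (hh : IsAlternating h) (c : ℤ) : IsAlternating (stepSum n c h) := by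
  intro τ y
  rw [stepSum_apply, stepSum_apply, Finset.mul_sum]
  refine Fintype.sum_equiv τ _ _ fun i => ?_
  rw [← hh]
  congr 1
  funext k
  simp [Pi.single_apply]

theorem stepSum_pow (hh : IsAlternating h) (c : ℤ) (N : ℕ) :
    IsAlternating ((_root_.stepSum n c ^ N) h) := by
  induction N with
  | zero => simpa
  | succ N ih => rw [pow_succ', Module.End.mul_apply]; exact ih.stepSum c

theorem eq_zero_of_eq (hh : IsAlternating h) {y : Fin n → ℤ} {i j : Fin n} (hij : i ≠ j)
    (hy : y i = y j) : h y = 0 := by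
  have h1 := hh (Equiv.swap i j) y
  have h2 : y ∘ Equiv.swap i j = y := by
    funext k
    simp only [Function.comp_apply, Equiv.swap_apply_def]
    split_ifs <;> simp_all
  rw [h2, Equiv.Perm.sign_swap hij] at h1
  push_cast at h1
  linear_combination h1 / 2

end IsAlternating

theorem stepSum_pow_eq_zero_of_sum_ne {n : ℕ} {h : (Fin n → ℤ) → ℂ} {d : ℤ}
    (hh : ∀ y, ∑ i, y i ≠ d → h y = 0) (c : ℤ) (N : ℕ) :
    ∀ y, ∑ i, y i ≠ d - N * c → (stepSum n c ^ N) h y = 0 := by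
  induction N with
  | zero => simpa using hh
  | succ N ih =>
    intro y hy
    rw [pow_succ', Module.End.mul_apply, stepSum_apply]
    refine Finset.sum_eq_zero fun i _ => ih _ fun h0 => hy ?_
    simp only [Pi.add_apply, Finset.sum_add_distrib, Finset.sum_pi_single', Finset.mem_univ,
      if_true] at h0
    push_cast
    linarith

theorem stepSum_pow_eq_zero_of_lt {n : ℕ} {h : (Fin n → ℤ) → ℂ} {b : ℤ}
    (hh : ∀ y i, y i < b → h y = 0) (N : ℕ) :
    ∀ y i, y i < b → (stepSum n (-1) ^ N) h y = 0 := by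
  induction N with
  | zero => simpa using hh
  | succ N ih =>
    intro y i hy
    rw [pow_succ', Module.End.mul_apply, stepSum_apply]
    refine Finset.sum_eq_zero fun k _ => ih _ i ?_
    simp only [Pi.add_apply, Pi.single_apply]
    split_ifs <;> omega

namespace YoungDiagram

/-- The strictly decreasing sequence `λ i - i` attached to a Young diagram with rows `λ i`. -/
def shifted (n : ℕ) (μ : YoungDiagram) : Fin n → ℤ := fun i => (μ.rowLen i : ℤ) - i

theorem rowLen_eq_zero_of_le {μ : YoungDiagram} {n k : ℕ} (h : μ.rowLen n = 0) (hk : n ≤ k) :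
    μ.rowLen k = 0 := by
  have := μ.rowLen_anti n k hk
  omega

theorem exists_addsBox_row (μ : YoungDiagram) (i : ℕ) (h : i = 0 ∨ μ.rowLen i < μ.rowLen (i - 1)) :
    ∃ ν : YoungDiagram, ∀ k, ν.rowLen k = μ.rowLen k + if k = i then 1 else 0 := by
  refine ⟨ofRowFun (μ.card + i + 1) fun k => μ.rowLen k + if k = i then 1 else 0,
    rowLen_ofRowFun ?_ ?_⟩
  · refine antitone_nat_of_succ_le fun k => ?_
    have := μ.rowLen_anti k (k + 1) k.le_succ
    split_ifs with h1 h2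
    · omega
    · subst h1
      rw [Nat.add_sub_cancel] at h
      omega
    · omega
    · omega
  · intro k hk
    rw [if_neg (by omega), add_zero]
    by_contra h0
    have h1 := mem_iff_lt_rowLen.2 (Nat.pos_of_ne_zero h0)
    have h2 := mem_iff_lt_colLen.1 h1
    have h3 := μ.colLen_le_card 0
    omega

theorem exists_removesBox_row (μ : YoungDiagram) (i : ℕ) (h : μ.rowLen (i + 1) < μ.rowLen i) :
    ∃ ν : YoungDiagram, ∀ k, μ.rowLen k = ν.rowLen k + if k = i then 1 else 0 := by
  have key : ∀ k, (ofRowFun μ.card fun k => μ.rowLen k - if k = i then 1 else 0).rowLen k =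
      μ.rowLen k - if k = i then 1 else 0 := by
    apply rowLen_ofRowFun
    · refine antitone_nat_of_succ_le fun k => ?_
      have := μ.rowLen_anti k (k + 1) k.le_succ
      split_ifs with h1 h2 h2
      · omega
      · omega
      · subst h2; omega
      · omega
    · intro k hk
      by_contra h0
      have h1 := mem_iff_lt_rowLen.2 (Nat.pos_of_ne_zero fun h : μ.rowLen k = 0 => h0 (by omega))
      have h2 := mem_iff_lt_colLen.1 h1
      have h3 := μ.colLen_le_card 0
      omega
  refine ⟨ofRowFun μ.card fun k => μ.rowLen k - if k = i then 1 else 0, fun k => ?_⟩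
  rw [key]
  split_ifs with h1
  · subst h1; omega
  · omega

theorem shifted_eq_add_single {n : ℕ} {ν μ : YoungDiagram} {i : Fin n}
    (h : ∀ k, μ.rowLen k = ν.rowLen k + if k = i then 1 else 0) :
    μ.shifted n = ν.shifted n + Pi.single i 1 := by
  funext k
  simp only [shifted, h, Pi.add_apply, Pi.single_apply, Fin.ext_iff]
  push_cast
  ring

theorem eq_of_single_add_eq {n : ℕ} {y : Fin n → ℤ} {i j : Fin n} {c : ℤ} (hc : c ≠ 0)
    (h : y + Pi.single i c = y + Pi.single j c) : i = j := by
  have := congrFun h i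
  by_contra hij
  simp [hij, hc] at this

open Classical in
/-- For an alternating function, only those coordinate increments that correspond to adding a box
contribute. -/
theorem stepSum_one_shifted {n N : ℕ} {h : (Fin n → ℤ) → ℂ} (hh : IsAlternating h)
    {μ : YoungDiagram} (hμ : μ ∈ (ofCard N).filter (rowLen · n = 0)) :
    stepSum n 1 h (μ.shifted n) =
      ∑ ν ∈ ((ofCard (N + 1)).filter (rowLen · n = 0)).filter (μ.AddsBox ·), h (ν.shifted n) := by
  rw [Finset.mem_filter, mem_ofCard] at hμ
  rw [stepSum_apply]
  symm
  have key : ∀ ν ∈ ((ofCard (N + 1)).filter (rowLen · n = 0)).filter (μ.AddsBox ·),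
      ∃ i : Fin n, ∀ k, ν.rowLen k = μ.rowLen k + if k = i then 1 else 0 := by
    intro ν hν
    rw [Finset.mem_filter, Finset.mem_filter, addsBox_iff_rowLen] at hν
    obtain ⟨⟨-, h0⟩, i, hi⟩ := hν
    have hin : i < n := by
      by_contra hin
      have h1 := hi i
      rw [if_pos rfl, rowLen_eq_zero_of_le h0 (by omega)] at h1
      omega
    exact ⟨⟨i, hin⟩, hi⟩
  choose f hf using key
  refine Finset.sum_bij_ne_zero (fun ν hν _ => f ν hν) (fun _ _ _ => Finset.mem_univ _) ?_ ?_ ?_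
  · intro ν hν _ ν' hν' _ hff
    refine ext_rowLen fun k => ?_
    rw [hf ν hν, hf ν' hν', hff]
  · intro i _ hi
    have hi' : (i : ℕ) = 0 ∨ μ.rowLen i < μ.rowLen (i - 1) := by
      by_contra! hcon
      obtain ⟨h1, h2⟩ := hcon
      have h3 := μ.rowLen_anti (i - 1) i (by omega)
      have hlt : (i : ℕ) - 1 < n := by omega
      have hne : (⟨i - 1, hlt⟩ : Fin n) ≠ i := by
        rw [Ne, Fin.ext_iff]; simp only; omega
      refine hi (hh.eq_zero_of_eq hne ?_)
      simp only [shifted, Pi.add_apply, Pi.single_apply, hne, if_true, if_false]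
      omega
    obtain ⟨ν, hν⟩ := exists_addsBox_row μ i hi'
    have hb : μ.AddsBox ν := addsBox_iff_rowLen.2 ⟨i, hν⟩
    have hmem : ν ∈ ((ofCard (N + 1)).filter (rowLen · n = 0)).filter (μ.AddsBox ·) := by
      rw [Finset.mem_filter, Finset.mem_filter, mem_ofCard, hb.card_eq, hμ.1, hν, hμ.2]
      exact ⟨⟨rfl, by rw [if_neg (by omega)]⟩, hb⟩
    have hfi : f ν hmem = i := eq_of_single_add_eq one_ne_zero
      ((shifted_eq_add_single (hf ν hmem)).symm.trans (shifted_eq_add_single hν))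
    refine ⟨ν, hmem, ?_, hfi⟩
    rwa [shifted_eq_add_single hν]
  · intro ν hν _
    rw [shifted_eq_add_single (hf ν hν)]

open Classical in
/-- For an alternating function supported above the ground state, only those coordinate decrements
that correspond to removing a box contribute. -/
theorem stepSum_neg_one_shifted {n N : ℕ} {h : (Fin n → ℤ) → ℂ} (hh : IsAlternating h)
    (hb : ∀ y i, y i < 1 - (n : ℤ) → h y = 0)
    {μ : YoungDiagram} (hμ : μ ∈ (ofCard (N + 1)).filter (rowLen · n = 0)) :
    stepSum n (-1) h (μ.shifted n) =
      ∑ ν ∈ ((ofCard N).filter (rowLen · n = 0)).filter (AddsBox · μ), h (ν.shifted n) := by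
  rw [Finset.mem_filter, mem_ofCard] at hμ
  rw [stepSum_apply]
  symm
  have hsub : ∀ {ν : YoungDiagram} {i : Fin n},
      (∀ k, μ.rowLen k = ν.rowLen k + if k = i then 1 else 0) →
      ν.shifted n = μ.shifted n + Pi.single i (-1) := by
    intro ν i h
    rw [shifted_eq_add_single h, add_assoc, ← Pi.single_add]
    simp
  have key : ∀ ν ∈ ((ofCard N).filter (rowLen · n = 0)).filter (AddsBox · μ),
      ∃ i : Fin n, ∀ k, μ.rowLen k = ν.rowLen k + if k = i then 1 else 0 := by
    intro ν hν
    rw [Finset.mem_filter, Finset.mem_filter, addsBox_iff_rowLen] at hν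
    obtain ⟨⟨-, h0⟩, i, hi⟩ := hν
    have hin : i < n := by
      by_contra hin
      have h1 := hi i
      rw [if_pos rfl, rowLen_eq_zero_of_le hμ.2 (by omega)] at h1
      omega
    exact ⟨⟨i, hin⟩, hi⟩
  choose f hf using key
  refine Finset.sum_bij_ne_zero (fun ν hν _ => f ν hν) (fun _ _ _ => Finset.mem_univ _) ?_ ?_ ?_
  · intro ν hν _ ν' hν' _ hff
    refine ext_rowLen fun k => ?_
    have h1 := hf ν hν k
    have h2 := hf ν' hν' k
    rw [hff] at h1
    omega
  · intro i _ hi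
    have hi' : μ.rowLen (i + 1) < μ.rowLen i := by
      by_contra! hcon
      have h3 := μ.rowLen_anti i (i + 1) (by omega)
      by_cases hlt : (i : ℕ) + 1 < n
      · have hne : (⟨i + 1, hlt⟩ : Fin n) ≠ i := by
          rw [Ne, Fin.ext_iff]; simp
        refine hi (hh.eq_zero_of_eq hne ?_)
        simp only [shifted, Pi.add_apply, Pi.single_apply, hne, if_true, if_false]
        push_cast
        omega
      · have h4 := rowLen_eq_zero_of_le hμ.2 (k := i + 1) (by omega)
        refine hi (hb _ i ?_)
        simp only [shifted, Pi.add_apply, Pi.single_apply, if_true]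
        omega
    obtain ⟨ν, hν⟩ := exists_removesBox_row μ i hi'
    have hadd : ν.AddsBox μ := addsBox_iff_rowLen.2 ⟨i, hν⟩
    have hmem : ν ∈ ((ofCard N).filter (rowLen · n = 0)).filter (AddsBox · μ) := by
      have h1 := hadd.card_eq
      have h2 := hν n
      rw [Finset.mem_filter, Finset.mem_filter, mem_ofCard]
      exact ⟨⟨by omega, by omega⟩, hadd⟩
    have hfi : f ν hmem = i := eq_of_single_add_eq (c := -1) (by decide)
      ((hsub (hf ν hmem)).symm.trans (hsub hν))
    refine ⟨ν, hmem, ?_, hfi⟩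
    rwa [hsub hν]
  · intro ν hν _
    rw [hsub (hf ν hν)]

open Classical in
theorem sum_filter_addsBox_card_chains {n N : ℕ} {μ : YoungDiagram} (hμ : μ.rowLen n = 0) :
    ((chains (N + 1) μ).card : ℂ) =
      ∑ ν ∈ ((ofCard N).filter (rowLen · n = 0)).filter (AddsBox · μ), ((chains N ν).card : ℂ) := by
  rw [card_chains_succ, Nat.cast_sum]
  refine Finset.sum_congr ?_ fun _ _ => rfl
  ext ν
  simp only [Finset.mem_filter]
  refine ⟨fun ⟨h1, h2⟩ => ⟨⟨h1, ?_⟩, h2⟩, fun ⟨⟨h1, _⟩, h2⟩ => ⟨h1, h2⟩⟩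
  obtain ⟨i, hi⟩ := addsBox_iff_rowLen.1 h2
  have := hi n
  omega

theorem chains_zero_bot : (chains 0 ⊥).card = 1 := by
  simp [chains]

theorem stepSum_neg_one_pow_shifted {n : ℕ} {h : (Fin n → ℤ) → ℂ} (hh : IsAlternating h)
    (hb : ∀ y i, y i < 1 - (n : ℤ) → h y = 0) (h0 : h (shifted n ⊥) = 1) {N : ℕ}
    {μ : YoungDiagram} (hcard : μ.card = N) (hμ : μ.rowLen n = 0) :
    (stepSum n (-1) ^ N) h (μ.shifted n) = (chains N μ).card := by
  induction N generalizing μ with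
  | zero =>
    rw [eq_bot_of_card_eq_zero hcard, chains_zero_bot]
    simpa using h0
  | succ N ih =>
    classical
    rw [pow_succ', Module.End.mul_apply, stepSum_neg_one_shifted (N := N) (hh.stepSum_pow _ _)
      (stepSum_pow_eq_zero_of_lt hb N) (by simp [hcard, hμ]), sum_filter_addsBox_card_chains hμ]
    refine Finset.sum_congr rfl fun ν hν => ?_
    simp only [Finset.mem_filter, mem_ofCard] at hν
    exact ih hν.1.1 hν.1.2

theorem stepSum_one_pow_shifted_bot {n : ℕ} (N : ℕ) {h : (Fin n → ℤ) → ℂ} (hh : IsAlternating h) :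
    (stepSum n 1 ^ N) h (shifted n ⊥) =
      ∑ μ ∈ (ofCard N).filter (rowLen · n = 0), ((chains N μ).card : ℂ) * h (μ.shifted n) := by
  induction N generalizing h with
  | zero =>
    have : (ofCard 0).filter (rowLen · n = 0) = {⊥} := by
      ext μ
      simp only [Finset.mem_filter, mem_ofCard, Finset.mem_singleton]
      constructor
      · exact fun h => eq_bot_of_card_eq_zero h.1
      · rintro rfl
        exact ⟨rfl, rowLen_bot n⟩
    rw [this, Finset.sum_singleton, chains_zero_bot]
    simp
  | succ N ih =>
    classical
    rw [pow_succ, Module.End.mul_apply, ih (hh.stepSum 1)]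
    calc ∑ μ ∈ (ofCard N).filter (rowLen · n = 0),
          ((chains N μ).card : ℂ) * stepSum n 1 h (μ.shifted n)
        = ∑ μ ∈ (ofCard N).filter (rowLen · n = 0),
            ∑ ν ∈ ((ofCard (N + 1)).filter (rowLen · n = 0)).filter (μ.AddsBox ·),
              ((chains N μ).card : ℂ) * h (ν.shifted n) :=
          Finset.sum_congr rfl fun μ hμ => by rw [stepSum_one_shifted hh hμ, Finset.mul_sum]
      _ = ∑ ν ∈ (ofCard (N + 1)).filter (rowLen · n = 0),
            ∑ μ ∈ ((ofCard N).filter (rowLen · n = 0)).filter (AddsBox · ν),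
              ((chains N μ).card : ℂ) * h (ν.shifted n) :=
          Finset.sum_comm' fun μ ν => by simp only [Finset.mem_filter]; tauto
      _ = _ := Finset.sum_congr rfl fun ν hν => by
          rw [sum_filter_addsBox_card_chains (Finset.mem_filter.1 hν).2, Finset.sum_mul]

end YoungDiagram

/-- The `k`-th Fourier coefficient of `exp (2 s cos θ)`. -/
noncomputable def expCosCoeff (k : ℤ) (s : ℂ) : ℂ :=
  (1 / (2 * π) : ℂ) * ∫ θ in (-π)..π,
    Complex.exp (2 * s * Real.cos θ) * Complex.exp (-k * θ * Complex.I)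

theorem expCosCoeff_zero (k : ℤ) : expCosCoeff k 0 = if k = 0 then 1 else 0 := by
  have hpi : (π : ℂ) ≠ 0 := by exact_mod_cast Real.pi_ne_zero
  rw [expCosCoeff]
  simp only [mul_zero, zero_mul, Complex.exp_zero, one_mul]
  split_ifs with hk
  · subst hk
    simp only [Int.cast_zero, neg_zero, zero_mul, Complex.exp_zero, intervalIntegral.integral_const]
    rw [Complex.real_smul]
    push_cast
    field_simp
    ring
  · have hc : (-k * Complex.I : ℂ) ≠ 0 :=
      mul_ne_zero (neg_ne_zero.2 (by exact_mod_cast hk)) Complex.I_ne_zero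
    have h1 : ∀ θ : ℝ, (-k * θ * Complex.I : ℂ) = (-k * Complex.I) * θ := fun θ => by ring
    simp only [h1]
    rw [integral_exp_mul_complex hc]
    have h2 : Complex.exp (-k * Complex.I * (π : ℝ)) =
        Complex.exp (-k * Complex.I * ((-π : ℝ) : ℂ)) := by
      rw [Complex.exp_eq_exp_iff_exists_int]
      exact ⟨-k, by push_cast; ring⟩
    rw [h2, sub_self, zero_div, mul_zero]

theorem hasDerivAt_expCosCoeff (k : ℤ) (s : ℂ) :
    HasDerivAt (expCosCoeff k) (expCosCoeff (k + 1) s + expCosCoeff (k - 1) s) s := by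
  have hcont : ∀ (s : ℂ) (k : ℤ), Continuous fun θ : ℝ =>
      Complex.exp (2 * s * Real.cos θ) * Complex.exp (-k * θ * Complex.I) := by
    intro s k; fun_prop
  have hsplit : ∀ θ : ℝ, 2 * (Real.cos θ : ℂ) *
      (Complex.exp (2 * s * Real.cos θ) * Complex.exp (-k * θ * Complex.I)) =
      Complex.exp (2 * s * Real.cos θ) * Complex.exp (-(k + 1 : ℤ) * θ * Complex.I) +
      Complex.exp (2 * s * Real.cos θ) * Complex.exp (-(k - 1 : ℤ) * θ * Complex.I) := by
    intro θ
    have h1 : (-(k + 1 : ℤ) * θ * Complex.I : ℂ) = -θ * Complex.I + -k * θ * Complex.I := by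
      push_cast; ring
    have h2 : (-(k - 1 : ℤ) * θ * Complex.I : ℂ) = θ * Complex.I + -k * θ * Complex.I := by
      push_cast; ring
    rw [h1, h2, Complex.exp_add, Complex.exp_add, Complex.ofReal_cos, Complex.cos]
    ring
  have key := (intervalIntegral.hasDerivAt_integral_of_dominated_loc_of_deriv_le
    (μ := volume) (a := -π) (b := π) (s := Metric.ball s 1) (x₀ := s)
    (F := fun s θ => Complex.exp (2 * s * Real.cos θ) * Complex.exp (-k * θ * Complex.I))
    (F' := fun s θ => 2 * (Real.cos θ : ℂ) *
      (Complex.exp (2 * s * Real.cos θ) * Complex.exp (-k * θ * Complex.I)))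
    (bound := fun _ => 2 * Real.exp (2 * (‖s‖ + 1)))
    (Metric.ball_mem_nhds s one_pos)
    (Filter.Eventually.of_forall fun x => (hcont x k).aestronglyMeasurable)
    ((hcont s k).intervalIntegrable _ _)
    (Continuous.aestronglyMeasurable (by fun_prop))
    (Filter.Eventually.of_forall fun θ _ x hx => ?_)
    intervalIntegrable_const
    (Filter.Eventually.of_forall fun θ _ x _ => ?_)).2
  · convert! key.const_mul (1 / (2 * π) : ℂ) using 1
    simp only [expCosCoeff, hsplit]
    rw [intervalIntegral.integral_add ((hcont _ _).intervalIntegrable _ _)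
      ((hcont _ _).intervalIntegrable _ _), mul_add]
  · have hx' : ‖x‖ ≤ ‖s‖ + 1 := by
      have := norm_sub_norm_le x s
      rw [Metric.mem_ball, dist_eq_norm] at hx
      linarith
    have h1 : ‖Complex.exp (-k * θ * Complex.I)‖ = 1 := by
      have : (-k * θ * Complex.I : ℂ) = ((-k * θ : ℝ) : ℂ) * Complex.I := by push_cast; ring
      rw [this, Complex.norm_exp_ofReal_mul_I]
    have hcos : ‖(Real.cos θ : ℂ)‖ ≤ 1 := by
      rw [Complex.norm_real]; exact Real.abs_cos_le_one θ
    have h2 : ‖Complex.exp (2 * x * Real.cos θ)‖ ≤ Real.exp (2 * (‖s‖ + 1)) := by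
      rw [Complex.norm_exp]
      refine Real.exp_le_exp.2 ((Complex.re_le_norm _).trans ?_)
      rw [norm_mul, norm_mul, Complex.norm_ofNat]
      nlinarith [norm_nonneg x, norm_nonneg (Real.cos θ : ℂ)]
    rw [norm_mul, norm_mul, norm_mul, h1, mul_one, Complex.norm_ofNat]
    exact mul_le_mul (by linarith) h2 (norm_nonneg _) (by norm_num)
  · have h := (((hasDerivAt_id x).const_mul 2).mul_const (Real.cos θ : ℂ)).cexp.mul_const
      (Complex.exp (-k * θ * Complex.I))
    simp only [id, mul_one] at h
    refine h.congr_deriv ?_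
    ring

/-- The determinant of Fourier coefficients of `exp (2 s cos θ)` with row shifts `y`. -/
noncomputable def expCosDet {n : ℕ} (s : ℂ) (y : Fin n → ℤ) : ℂ :=
  (Matrix.of fun i j : Fin n => expCosCoeff (y i + j) s).det

theorem isAlternating_expCosDet {n : ℕ} (s : ℂ) : IsAlternating (expCosDet (n := n) s) := by
  intro τ y
  exact_mod_cast Matrix.det_permute τ (Matrix.of fun i j : Fin n => expCosCoeff (y i + j) s)

theorem expCosDet_eq_sum {n : ℕ} (s : ℂ) (y : Fin n → ℤ) :
    expCosDet s y = ∑ σ : Equiv.Perm (Fin n),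
      ((Equiv.Perm.sign σ : ℤ) : ℂ) * ∏ i, expCosCoeff (y (σ i) + i) s := by
  rw [expCosDet, Matrix.det_apply']
  rfl

theorem stepSum_expCosDet {n : ℕ} (c : ℤ) (s : ℂ) (y : Fin n → ℤ) :
    stepSum n c (expCosDet s) y = ∑ σ : Equiv.Perm (Fin n), ((Equiv.Perm.sign σ : ℤ) : ℂ) *
      ∑ i, (∏ j ∈ Finset.univ.erase i, expCosCoeff (y (σ j) + j) s) *
        expCosCoeff (y (σ i) + i + c) s := by
  simp only [stepSum_apply, expCosDet_eq_sum]
  rw [Finset.sum_comm]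
  refine Finset.sum_congr rfl fun σ _ => ?_
  rw [← Finset.mul_sum, ← Equiv.sum_comp σ]
  congr 1
  refine Finset.sum_congr rfl fun i _ => ?_
  rw [← Finset.prod_erase_mul _ _ (Finset.mem_univ i)]
  congr 1
  · refine Finset.prod_congr rfl fun j hj => ?_
    simp [(Finset.mem_erase.1 hj).1]
  · congr 1
    simp only [Pi.add_apply, Pi.single_eq_same]
    ring

theorem hasDerivAt_expCosDet {n : ℕ} (s : ℂ) (y : Fin n → ℤ) :
    HasDerivAt (fun s => expCosDet s y)
      ((stepSum n 1 + stepSum n (-1)) (expCosDet s) y) s := by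
  simp only [LinearMap.add_apply, Pi.add_apply, stepSum_expCosDet, ← Finset.sum_add_distrib,
    ← mul_add, ← sub_eq_add_neg]
  simp only [expCosDet_eq_sum]
  refine HasDerivAt.fun_sum fun σ _ => HasDerivAt.const_mul _ ?_
  exact HasDerivAt.fun_finsetProd fun i _ => hasDerivAt_expCosCoeff _ s

theorem hasDerivAt_stepSum {n : ℕ} {H : ℂ → (Fin n → ℤ) → ℂ} {H' : (Fin n → ℤ) → ℂ} {s : ℂ}
    (hH : ∀ y, HasDerivAt (fun s => H s y) (H' y) s) (c : ℤ) (y : Fin n → ℤ) :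
    HasDerivAt (fun s => stepSum n c (H s) y) (stepSum n c H' y) s := by
  simp only [stepSum_apply]
  exact HasDerivAt.fun_sum fun i _ => hH (y + Pi.single i c)

theorem hasDerivAt_pow_expCosDet {n : ℕ} (M : ℕ) (s : ℂ) (y : Fin n → ℤ) :
    HasDerivAt (fun s => ((stepSum n 1 + stepSum n (-1)) ^ M) (expCosDet s) y)
      (((stepSum n 1 + stepSum n (-1)) ^ (M + 1)) (expCosDet s) y) s := by
  induction M generalizing y with
  | zero => simpa using hasDerivAt_expCosDet s y
  | succ M ih =>
    rw [pow_succ' _ (M + 1)]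
    conv =>
      arg 1
      ext s
      rw [pow_succ' _ M]
    exact (hasDerivAt_stepSum ih 1 y).add (hasDerivAt_stepSum ih (-1) y)

theorem iteratedDeriv_expCosDet {n : ℕ} (M : ℕ) (y : Fin n → ℤ) :
    iteratedDeriv M (fun s => expCosDet s y) =
      fun s => ((stepSum n 1 + stepSum n (-1)) ^ M) (expCosDet s) y := by
  induction M with
  | zero => simp
  | succ M ih =>
    rw [iteratedDeriv_succ, ih]
    funext s
    exact (hasDerivAt_pow_expCosDet M s y).deriv

theorem expCosDet_zero_eq_zero_of_lt {n : ℕ} (y : Fin n → ℤ) (i : Fin n) (h : y i < 1 - (n : ℤ)) :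
    expCosDet 0 y = 0 := by
  refine Matrix.det_eq_zero_of_row_eq_zero i fun j => ?_
  rw [Matrix.of_apply, expCosCoeff_zero, if_neg]
  have := j.isLt
  omega

theorem expCosDet_zero_shifted_bot (n : ℕ) :
    expCosDet 0 (YoungDiagram.shifted n ⊥) = 1 := by
  have : (Matrix.of fun i j : Fin n => expCosCoeff (YoungDiagram.shifted n ⊥ i + j) 0) = 1 := by
    ext i j
    rw [Matrix.of_apply, expCosCoeff_zero, Matrix.one_apply, YoungDiagram.shifted,
      YoungDiagram.rowLen_bot]
    congr 1
    rw [Fin.ext_iff, eq_iff_iff]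
    push_cast
    omega
  rw [expCosDet, this, Matrix.det_one]

theorem expCosDet_zero_eq_zero_of_sum_ne {n : ℕ} (y : Fin n → ℤ)
    (h : ∑ i, y i ≠ ∑ i, YoungDiagram.shifted n ⊥ i) : expCosDet 0 y = 0 := by
  rw [expCosDet_eq_sum]
  refine Finset.sum_eq_zero fun σ _ => ?_
  by_contra h0
  apply h
  rw [← Equiv.sum_comp σ]
  refine Finset.sum_congr rfl fun i _ => ?_
  have h1 := Finset.prod_ne_zero_iff.1 (right_ne_zero_of_mul h0) i (Finset.mem_univ i)
  rw [expCosCoeff_zero, ite_ne_right_iff] at h1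
  rw [YoungDiagram.shifted, YoungDiagram.rowLen_bot]
  have := h1.1
  push_cast
  omega

theorem stepSum_pow_add_expCosDet_zero (n k l : ℕ) (hkl : k ≠ l) :
    (stepSum n 1 ^ k * stepSum n (-1) ^ l) (expCosDet 0) (YoungDiagram.shifted n ⊥) = 0 := by
  rw [Module.End.mul_apply]
  refine stepSum_pow_eq_zero_of_sum_ne (stepSum_pow_eq_zero_of_sum_ne
    expCosDet_zero_eq_zero_of_sum_ne (-1) l) 1 k _ ?_
  omega

open YoungDiagram in
theorem stepSum_pow_mul_expCosDet_zero (n N : ℕ) :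
    (stepSum n 1 ^ N * stepSum n (-1) ^ N) (expCosDet 0) (shifted n ⊥) =
      ∑ μ ∈ (ofCard N).filter (rowLen · n = 0), ((chains N μ).card : ℂ) ^ 2 := by
  have h0 := isAlternating_expCosDet (n := n) 0
  rw [Module.End.mul_apply, stepSum_one_pow_shifted_bot N (h0.stepSum_pow (-1) N)]
  refine Finset.sum_congr rfl fun μ hμ => ?_
  rw [Finset.mem_filter, mem_ofCard] at hμ
  rw [stepSum_neg_one_pow_shifted h0 expCosDet_zero_eq_zero_of_lt (expCosDet_zero_shifted_bot n)
    hμ.1 hμ.2, sq]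

open YoungDiagram in
/-- The expansion of the Toeplitz determinant in terms of numbers of standard Young tableaux. -/
theorem hasSum_expCosDet (n : ℕ) (s : ℂ) :
    HasSum (fun N : ℕ => s ^ (2 * N) / (N.factorial : ℂ) ^ 2 *
      ∑ μ ∈ (ofCard N).filter (rowLen · n = 0), ((chains N μ).card : ℂ) ^ 2)
      (expCosDet s (shifted n ⊥)) := by
  have h1 := Complex.hasSum_taylorSeries_of_entire (f := fun s => expCosDet s (shifted n ⊥))
    (fun s => (hasDerivAt_expCosDet s _).differentiableAt) 0 s
  have hinj : Function.Injective fun N : ℕ => 2 * N := fun a b h => by simpa using h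
  have hcoeff : ∀ M, iteratedDeriv M (fun s => expCosDet s (shifted n ⊥)) 0 =
      ∑ k ∈ Finset.range (M + 1), (M.choose k : ℂ) *
        (stepSum n 1 ^ k * stepSum n (-1) ^ (M - k)) (expCosDet 0) (shifted n ⊥) := by
    intro M
    rw [iteratedDeriv_expCosDet, (stepSum_commute n 1 (-1)).add_pow]
    simp_rw [← nsmul_eq_mul']
    simp only [LinearMap.sum_apply, LinearMap.smul_apply, Finset.sum_apply, Pi.smul_apply]
    simp only [nsmul_eq_mul]
  rw [← hinj.hasSum_iff] at h1
  · convert! h1 using 2 with N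
    rw [Function.comp_apply, hcoeff, Finset.sum_eq_single N]
    · rw [two_mul, Nat.add_sub_cancel, stepSum_pow_mul_expCosDet_zero,
        ← Nat.add_choose_mul_factorial_mul_factorial N N]
      have hN : (N.factorial : ℂ) ≠ 0 := by exact_mod_cast N.factorial_ne_zero
      have hc : ((N + N).choose N : ℂ) ≠ 0 := by
        exact_mod_cast (Nat.choose_pos (Nat.le_add_left N N)).ne'
      push_cast
      rw [smul_eq_mul, smul_eq_mul, sub_zero]
      field_simp
    · intro k hk hkN
      rw [Finset.mem_range] at hk
      rw [stepSum_pow_add_expCosDet_zero _ _ _ (by omega), mul_zero]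
    · intro h
      exact absurd (Finset.mem_range.2 (by omega)) h
  · intro M hM
    rw [hcoeff, Finset.sum_eq_zero, smul_zero, smul_zero]
    intro k hk
    rw [Finset.mem_range] at hk
    rw [stepSum_pow_add_expCosDet_zero, mul_zero]
    intro h
    exact hM ⟨k, by simp only; omega⟩

/-- The sequence `μ` is obtained from `ρ` by adding a horizontal strip. -/
def HorizontalStrip (ρ μ : ℕ → ℕ) : Prop :=
  ∀ k, ρ k ≤ μ k ∧ μ (k + 1) ≤ ρ k

theorem HorizontalStrip.antitone {ρ μ : ℕ → ℕ} (h : HorizontalStrip ρ μ) : Antitone μ :=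
  antitone_nat_of_succ_le fun k => (h k).2.trans (h k).1

/-- The growth diagram of a matrix `X`: `growth X i j` lists the row lengths of the shape attached
to the submatrix formed by the first `i` rows and the first `j` columns. -/
def growth (X : ℕ → ℕ → ℕ) : ℕ → ℕ → ℕ → ℕ
  | 0, _, _ => 0
  | _ + 1, 0, _ => 0
  | i + 1, j + 1, 0 => max (growth X (i + 1) j 0) (growth X i (j + 1) 0) + X i j
  | i + 1, j + 1, k + 1 => max (growth X (i + 1) j (k + 1)) (growth X i (j + 1) (k + 1)) +
      (min (growth X (i + 1) j k) (growth X i (j + 1) k) - growth X i j k)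

section growth

variable (X : ℕ → ℕ → ℕ)

theorem growth_zero_left (j k : ℕ) : growth X 0 j k = 0 := by
  rw [growth]

theorem growth_zero_right (i k : ℕ) : growth X i 0 k = 0 := by
  cases i <;> rw [growth]

theorem growth_succ_zero (i j : ℕ) : growth X (i + 1) (j + 1) 0 =
    max (growth X (i + 1) j 0) (growth X i (j + 1) 0) + X i j := by
  rw [growth]

theorem growth_succ_succ (i j k : ℕ) : growth X (i + 1) (j + 1) (k + 1) =
    max (growth X (i + 1) j (k + 1)) (growth X i (j + 1) (k + 1)) +
      (min (growth X (i + 1) j k) (growth X i (j + 1) k) - growth X i j k) := by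
  rw [growth]

theorem growth_horizontalStrip (i j : ℕ) :
    HorizontalStrip (growth X i j) (growth X (i + 1) j) ∧
      HorizontalStrip (growth X i j) (growth X i (j + 1)) := by
  have step : ∀ i j, HorizontalStrip (growth X i j) (growth X (i + 1) j) →
      HorizontalStrip (growth X i j) (growth X i (j + 1)) →
      HorizontalStrip (growth X i (j + 1)) (growth X (i + 1) (j + 1)) ∧
        HorizontalStrip (growth X (i + 1) j) (growth X (i + 1) (j + 1)) := by
    intro i j h1 h2
    have h3 := growth_succ_zero X i j
    refine ⟨fun k => ?_, fun k => ?_⟩ <;>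
    · have h4 := growth_succ_succ X i j k
      have h5 := h1 k
      have h6 := h2 k
      cases k with
      | zero => omega
      | succ k =>
        have h7 := growth_succ_succ X i j k
        omega
  have main : ∀ m i j, i + j = m → HorizontalStrip (growth X i j) (growth X (i + 1) j) ∧
      HorizontalStrip (growth X i j) (growth X i (j + 1)) := by
    intro m
    induction m with
    | zero =>
      intro i j h
      obtain ⟨rfl, rfl⟩ : i = 0 ∧ j = 0 := by omega
      simp [HorizontalStrip, growth_zero_left, growth_zero_right]
    | succ m ih =>
      intro i j h
      constructor
      · cases j with
        | zero => simp [HorizontalStrip, growth_zero_right]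
        | succ j => exact (step i j (ih i j (by omega)).1 (ih i j (by omega)).2).1
      · cases i with
        | zero => simp [HorizontalStrip, growth_zero_left]
        | succ i => exact (step i j (ih i j (by omega)).1 (ih i j (by omega)).2).2
  exact main _ i j rfl

theorem growth_antitone (i j : ℕ) : Antitone (growth X i j) := by
  cases i with
  | zero => intro a b _; simp [growth_zero_left]
  | succ i => exact (growth_horizontalStrip X i j).1.antitone

theorem growth_le_succ_left (i j k : ℕ) : growth X i j k ≤ growth X (i + 1) j k :=
  ((growth_horizontalStrip X i j).1 k).1

theorem growth_le_succ_right (i j k : ℕ) : growth X i j k ≤ growth X i (j + 1) k :=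
  ((growth_horizontalStrip X i j).2 k).1

/-- The local rule in a symmetric form. -/
theorem growth_add (i j k : ℕ) : growth X (i + 1) (j + 1) (k + 1) + growth X i j k =
    max (growth X (i + 1) j (k + 1)) (growth X i (j + 1) (k + 1)) +
      min (growth X (i + 1) j k) (growth X i (j + 1) k) := by
  have h1 := growth_succ_succ X i j k
  have h2 := growth_le_succ_left X i j k
  have h3 := growth_le_succ_right X i j k
  omega

theorem growth_eq_zero_of_le {i j k : ℕ} (h : i ≤ k) : growth X i j k = 0 := by
  induction i generalizing j k with
  | zero => exact growth_zero_left X j k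
  | succ i ih =>
    induction j with
    | zero => exact growth_zero_right X _ k
    | succ j ihj =>
      obtain ⟨k, rfl⟩ : ∃ l, k = l + 1 := ⟨k - 1, by omega⟩
      have h1 := growth_succ_succ X i j k
      have h2 := ih (j := j + 1) (k := k) (by omega)
      have h3 := ih (j := j + 1) (k := k + 1) (by omega)
      omega

theorem sum_growth_succ_succ (i j K : ℕ) (hK : i ≤ K) :
    ∑ k ∈ Finset.range (K + 1), growth X (i + 1) (j + 1) k +
        ∑ k ∈ Finset.range (K + 1), growth X i j k =
      ∑ k ∈ Finset.range (K + 1), growth X (i + 1) j k +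
        ∑ k ∈ Finset.range (K + 1), growth X i (j + 1) k + X i j := by
  have key : ∀ L, ∑ k ∈ Finset.range (L + 1), growth X (i + 1) (j + 1) k +
        ∑ k ∈ Finset.range L, growth X i j k +
        min (growth X (i + 1) j L) (growth X i (j + 1) L) =
      ∑ k ∈ Finset.range (L + 1), growth X (i + 1) j k +
        ∑ k ∈ Finset.range (L + 1), growth X i (j + 1) k + X i j := by
    intro L
    induction L with
    | zero =>
      have := growth_succ_zero X i j
      simp only [zero_add, Finset.sum_range_one, Finset.sum_range_zero]
      omega
    | succ L ih =>
      rw [Finset.sum_range_succ (fun k => growth X (i + 1) (j + 1) k) (L + 1),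
        Finset.sum_range_succ (fun k => growth X i j k) L,
        Finset.sum_range_succ (fun k => growth X (i + 1) j k) (L + 1),
        Finset.sum_range_succ (fun k => growth X i (j + 1) k) (L + 1)]
      have := growth_add X i j L
      omega
  have h1 := key K
  have h2 := growth_eq_zero_of_le X (j := j + 1) hK
  have h3 := growth_eq_zero_of_le X (j := j) hK
  rw [Finset.sum_range_succ (fun k => growth X i j k)]
  omega

theorem sum_growth_succ_left (i j K : ℕ) (hK : i ≤ K) :
    ∑ k ∈ Finset.range (K + 1), growth X (i + 1) j k =
      ∑ k ∈ Finset.range (K + 1), growth X i j k + ∑ b ∈ Finset.range j, X i b := by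
  induction j with
  | zero => simp [growth_zero_right]
  | succ j ih =>
    rw [Finset.sum_range_succ _ j]
    have := sum_growth_succ_succ X i j K hK
    omega

theorem sum_growth_succ_right (i j K : ℕ) (hK : i ≤ K + 1) :
    ∑ k ∈ Finset.range (K + 1), growth X i (j + 1) k =
      ∑ k ∈ Finset.range (K + 1), growth X i j k + ∑ a ∈ Finset.range i, X a j := by
  induction i with
  | zero => simp [growth_zero_left]
  | succ i ih =>
    rw [Finset.sum_range_succ _ i]
    have := sum_growth_succ_succ X i j K (by omega)
    have := ih (by omega)
    omega

end growth

theorem growth_congr {X Y : ℕ → ℕ → ℕ} {N : ℕ} (h : ∀ i < N, ∀ j < N, X i j = Y i j) :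
    ∀ i ≤ N, ∀ j ≤ N, ∀ k, growth X i j k = growth Y i j k := by
  intro i
  induction i with
  | zero => intro _ j _ k; rw [growth_zero_left, growth_zero_left]
  | succ i ih =>
    intro hi j
    induction j with
    | zero => intro _ k; rw [growth_zero_right, growth_zero_right]
    | succ j ihj =>
      intro hj k
      cases k with
      | zero =>
        rw [growth_succ_zero, growth_succ_zero, ihj (by omega), ih (by omega) _ hj,
          h i (by omega) j (by omega)]
      | succ k =>
        rw [growth_succ_succ, growth_succ_succ, ihj (by omega), ih (by omega) _ hj,
          ihj (by omega), ih (by omega) _ hj, ih (by omega) _ (by omega)]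

/-- The growth diagram is determined by its outer boundary. -/
theorem growth_eq_of_boundary_eq {X Y : ℕ → ℕ → ℕ} {N : ℕ}
    (h1 : ∀ j ≤ N, ∀ k, growth X N j k = growth Y N j k)
    (h2 : ∀ i ≤ N, ∀ k, growth X i N k = growth Y i N k) :
    ∀ a ≤ N, ∀ b ≤ N, ∀ k, growth X (N - a) (N - b) k = growth Y (N - a) (N - b) k := by
  intro a
  induction a with
  | zero => intro _ b _ k; exact h1 _ (by omega) k
  | succ a ih =>
    intro ha b
    induction b with
    | zero => intro _ k; exact h2 _ (by omega) k
    | succ b ihb =>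
      intro hb k
      obtain ⟨i, hi⟩ : ∃ i, N - a = i + 1 := ⟨N - a - 1, by omega⟩
      obtain ⟨j, hj⟩ : ∃ j, N - b = j + 1 := ⟨N - b - 1, by omega⟩
      have hi' : N - (a + 1) = i := by omega
      have hj' : N - (b + 1) = j := by omega
      have e1 := ih (by omega) b (by omega)
      have e2 := ihb (by omega)
      have e3 := ih (by omega) (b + 1) hb
      rw [hi', hj']
      rw [hi, hj] at e1
      rw [hi', hj] at e2
      rw [hi, hj'] at e3
      have g1 := growth_add X i j k
      have g2 := growth_add Y i j k
      rw [e1, e2, e2, e3, e3] at g1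
      omega

theorem eq_of_growth_boundary_eq {X Y : ℕ → ℕ → ℕ} {N : ℕ}
    (h1 : ∀ j ≤ N, ∀ k, growth X N j k = growth Y N j k)
    (h2 : ∀ i ≤ N, ∀ k, growth X i N k = growth Y i N k) :
    ∀ i < N, ∀ j < N, X i j = Y i j := by
  intro i hi j hj
  have key : ∀ a ≤ N, ∀ b ≤ N, growth X a b 0 = growth Y a b 0 := by
    intro a ha b hb
    have := growth_eq_of_boundary_eq h1 h2 (N - a) (by omega) (N - b) (by omega) 0
    rwa [Nat.sub_sub_self ha, Nat.sub_sub_self hb] at this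
  have g1 := growth_succ_zero X i j
  have g2 := growth_succ_zero Y i j
  rw [key (i + 1) hi (j + 1) hj, key (i + 1) hi j hj.le, key i hi.le (j + 1) hj] at g1
  omega

/-- The growth diagram reconstructed from its outer boundary; the indices count the distance to the
top right corner. -/
def coGrowth (p q : ℕ → ℕ → ℕ) : ℕ → ℕ → ℕ → ℕ
  | 0, j, k => p j k
  | i + 1, 0, k => q (i + 1) k
  | i + 1, j + 1, k => max (coGrowth p q (i + 1) j (k + 1)) (coGrowth p q i (j + 1) (k + 1)) +
      min (coGrowth p q (i + 1) j k) (coGrowth p q i (j + 1) k) - coGrowth p q i j (k + 1)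

section coGrowth

variable {p q : ℕ → ℕ → ℕ}

theorem coGrowth_zero_left (j k : ℕ) : coGrowth p q 0 j k = p j k := by
  rw [coGrowth]

theorem coGrowth_zero_right (h : p 0 = q 0) (i k : ℕ) : coGrowth p q i 0 k = q i k := by
  cases i with
  | zero => rw [coGrowth, h]
  | succ i => rw [coGrowth]

theorem coGrowth_horizontalStrip (h : p 0 = q 0) (hp : ∀ t, HorizontalStrip (p (t + 1)) (p t))
    (hq : ∀ t, HorizontalStrip (q (t + 1)) (q t)) (i j : ℕ) :
    HorizontalStrip (coGrowth p q (i + 1) j) (coGrowth p q i j) ∧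
      HorizontalStrip (coGrowth p q i (j + 1)) (coGrowth p q i j) := by
  have step : ∀ i j, HorizontalStrip (coGrowth p q (i + 1) j) (coGrowth p q i j) →
      HorizontalStrip (coGrowth p q i (j + 1)) (coGrowth p q i j) →
      HorizontalStrip (coGrowth p q (i + 1) (j + 1)) (coGrowth p q i (j + 1)) ∧
        HorizontalStrip (coGrowth p q (i + 1) (j + 1)) (coGrowth p q (i + 1) j) := by
    intro i j h1 h2
    have h3 : ∀ k, coGrowth p q (i + 1) (j + 1) k =
        max (coGrowth p q (i + 1) j (k + 1)) (coGrowth p q i (j + 1) (k + 1)) +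
        min (coGrowth p q (i + 1) j k) (coGrowth p q i (j + 1) k) - coGrowth p q i j (k + 1) :=
      fun k => by rw [coGrowth]
    refine ⟨fun k => ?_, fun k => ?_⟩ <;>
    · have h4 := h3 k
      have h5 := h1 k
      have h6 := h2 k
      have h7 := h1 (k + 1)
      have h8 := h2 (k + 1)
      omega
  have main : ∀ m i j, i + j = m → HorizontalStrip (coGrowth p q (i + 1) j) (coGrowth p q i j) ∧
      HorizontalStrip (coGrowth p q i (j + 1)) (coGrowth p q i j) := by
    intro m
    induction m with
    | zero =>
      intro i j hm
      obtain ⟨rfl, rfl⟩ : i = 0 ∧ j = 0 := by omega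
      have h0 := hp 0
      have h1 := hq 0
      simp only [HorizontalStrip, coGrowth_zero_right h, coGrowth_zero_left] at h0 h1 ⊢
      exact ⟨h1, fun k => by rw [← h]; exact h0 k⟩
    | succ m ih =>
      intro i j hm
      constructor
      · cases j with
        | zero => simpa only [HorizontalStrip, coGrowth_zero_right h] using hq i
        | succ j => exact (step i j (ih i j (by omega)).1 (ih i j (by omega)).2).1
      · cases i with
        | zero => simpa only [HorizontalStrip, coGrowth_zero_left] using hp j
        | succ i => exact (step i j (ih i j (by omega)).1 (ih i j (by omega)).2).2
  exact main _ i j rfl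

/-- Every pair of chains of horizontal strips ending at the same shape is the outer boundary of a
growth diagram. -/
theorem exists_growth_eq {N : ℕ} (h : p 0 = q 0) (hp : ∀ t, HorizontalStrip (p (t + 1)) (p t))
    (hq : ∀ t, HorizontalStrip (q (t + 1)) (q t)) (hpN : ∀ k, p N k = 0) (hqN : ∀ k, q N k = 0) :
    ∃ X : ℕ → ℕ → ℕ, (∀ b ≤ N, ∀ k, growth X N (N - b) k = p b k) ∧
      ∀ a ≤ N, ∀ k, growth X (N - a) N k = q a k := by
  have hs := coGrowth_horizontalStrip h hp hq
  have hright : ∀ i k, coGrowth p q i N k = 0 := by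
    intro i k
    induction i with
    | zero => rw [coGrowth_zero_left, hpN]
    | succ i ih => have := ((hs i N).1 k).1; omega
  have hleft : ∀ j k, coGrowth p q N j k = 0 := by
    intro j k
    induction j with
    | zero => rw [coGrowth_zero_right h, hqN]
    | succ j ih => have := ((hs N j).2 k).1; omega
  let X : ℕ → ℕ → ℕ := fun i j => coGrowth p q (N - (i + 1)) (N - (j + 1)) 0 -
    max (coGrowth p q (N - (i + 1)) (N - j) 0) (coGrowth p q (N - i) (N - (j + 1)) 0)
  have key : ∀ i ≤ N, ∀ j ≤ N, ∀ k, growth X i j k = coGrowth p q (N - i) (N - j) k := by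
    intro i
    induction i with
    | zero => intro _ j _ k; rw [growth_zero_left, Nat.sub_zero, hleft]
    | succ i ih =>
      intro hi j
      induction j with
      | zero => intro _ k; rw [growth_zero_right, Nat.sub_zero, hright]
      | succ j ihj =>
        intro hj k
        obtain ⟨a, ha⟩ : ∃ a, N - (i + 1) = a := ⟨_, rfl⟩
        obtain ⟨b, hb⟩ : ∃ b, N - (j + 1) = b := ⟨_, rfl⟩
        have ha' : N - i = a + 1 := by omega
        have hb' : N - j = b + 1 := by omega
        have e1 := ih (by omega) (j + 1) hj
        have e2 := ihj (by omega)
        have e3 := ih (by omega) j (by omega)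
        rw [ha', hb] at e1
        rw [ha, hb'] at e2
        rw [ha', hb'] at e3
        rw [ha, hb]
        have s1 := hs a b
        cases k with
        | zero =>
          rw [growth_succ_zero, e1, e2]
          simp only [X, ha, hb, ha', hb']
          have := (s1.1 0).1
          have := (s1.2 0).1
          omega
        | succ k =>
          rw [growth_succ_succ, e1, e1, e2, e2, e3]
          have h3 : coGrowth p q (a + 1) (b + 1) k =
            max (coGrowth p q (a + 1) b (k + 1)) (coGrowth p q a (b + 1) (k + 1)) +
            min (coGrowth p q (a + 1) b k) (coGrowth p q a (b + 1) k) -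
              coGrowth p q a b (k + 1) := by rw [coGrowth]
          have := s1.1 k
          have := s1.2 k
          have := s1.1 (k + 1)
          have := s1.2 (k + 1)
          omega
  refine ⟨X, fun b hb k => ?_, fun a ha k => ?_⟩
  · rw [key N le_rfl _ (by omega), Nat.sub_self, Nat.sub_sub_self hb, coGrowth_zero_left]
  · rw [key _ (by omega) N le_rfl, Nat.sub_self, Nat.sub_sub_self ha, coGrowth_zero_right h]

end coGrowth

/-- The permutation matrix of `σ`, extended by zero. -/
noncomputable def permMatrix {N : ℕ} (σ : Equiv.Perm (Fin N)) (i j : ℕ) : ℕ :=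
  open Classical in if ∃ h : i < N, (σ ⟨i, h⟩ : ℕ) = j then 1 else 0

section permMatrix

variable {N : ℕ} (σ : Equiv.Perm (Fin N))

theorem permMatrix_val (a : Fin N) (j : ℕ) :
    permMatrix σ a j = if (σ a : ℕ) = j then 1 else 0 := by
  simp [permMatrix, a.2]

theorem permMatrix_eq_zero_or (i j : ℕ) :
    permMatrix σ i j = 0 ∨ permMatrix σ i j = 1 ∧ ∃ a : Fin N, (a : ℕ) = i ∧ (σ a : ℕ) = j := by
  classical
  by_cases h : ∃ h : i < N, (σ ⟨i, h⟩ : ℕ) = j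
  · exact Or.inr ⟨if_pos h, ⟨i, h.1⟩, rfl, h.2⟩
  · exact Or.inl (if_neg h)

theorem sum_permMatrix_row {i : ℕ} (hi : i < N) : ∑ j ∈ Finset.range N, permMatrix σ i j = 1 := by
  have h := permMatrix_val σ ⟨i, hi⟩
  simp only at h
  simp only [h]
  rw [Finset.sum_ite_eq, if_pos (Finset.mem_range.2 (σ _).2)]

theorem sum_permMatrix_col {j : ℕ} (hj : j < N) : ∑ i ∈ Finset.range N, permMatrix σ i j = 1 := by
  rw [← Fin.sum_univ_eq_sum_range (fun i => permMatrix σ i j),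
    Finset.sum_eq_single (σ.symm ⟨j, hj⟩)]
  · simp [permMatrix_val]
  · intro a _ ha
    rw [permMatrix_val, if_neg]
    rintro h
    exact ha (by rw [Equiv.eq_symm_apply, Fin.ext_iff, h])
  · simp

theorem permMatrix_injective {σ τ : Equiv.Perm (Fin N)}
    (h : ∀ i < N, ∀ j < N, permMatrix σ i j = permMatrix τ i j) : σ = τ := by
  ext a
  have := h a a.2 (τ a) (τ a).2
  rw [permMatrix_val, permMatrix_val, if_pos rfl] at this
  by_contra h
  simp [h] at this

theorem exists_permMatrix_eq {X : ℕ → ℕ → ℕ}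
    (hrow : ∀ i < N, ∑ j ∈ Finset.range N, X i j = 1)
    (hcol : ∀ j < N, ∑ i ∈ Finset.range N, X i j = 1) :
    ∃ σ : Equiv.Perm (Fin N), ∀ i < N, ∀ j < N, X i j = permMatrix σ i j := by
  have hex : ∀ a : Fin N, ∃ b : Fin N, X a b = 1 ∧ ∀ j < N, j ≠ b → X a j = 0 := by
    intro a
    obtain ⟨b, hb, hne⟩ := Finset.exists_ne_zero_of_sum_ne_zero
      (by rw [hrow a a.2]; exact one_ne_zero)
    have h := hrow a a.2
    rw [← Finset.add_sum_erase _ _ hb] at h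
    refine ⟨⟨b, Finset.mem_range.1 hb⟩, by simp only; omega, fun j hj hjb => ?_⟩
    have h0 : ∑ j ∈ (Finset.range N).erase b, X a j = 0 := by omega
    exact Finset.sum_eq_zero_iff.1 h0 j (Finset.mem_erase.2 ⟨hjb, Finset.mem_range.2 hj⟩)
  choose f hf1 hf0 using hex
  have hinj : Function.Injective f := by
    intro a a' haa
    by_contra hne
    have h := hcol (f a) (f a).2
    rw [← Fin.sum_univ_eq_sum_range (fun i => X i (f a))] at h
    have h2 : ∑ i ∈ {a, a'}, X i (f a) ≤ ∑ i : Fin N, X i (f a) :=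
      Finset.sum_le_sum_of_subset (Finset.subset_univ _)
    rw [Finset.sum_pair hne, hf1, haa, hf1, ← haa, h] at h2
    omega
  refine ⟨Equiv.ofBijective f (Finite.injective_iff_bijective.1 hinj), fun i hi j hj => ?_⟩
  have h := permMatrix_val (Equiv.ofBijective f (Finite.injective_iff_bijective.1 hinj)) ⟨i, hi⟩ j
  simp only [Equiv.ofBijective_apply] at h
  rw [h]
  split_ifs with hj'
  · rw [← hj']; exact hf1 ⟨i, hi⟩
  · exact hf0 ⟨i, hi⟩ j hj (Ne.symm hj')

theorem card_le_growth_permMatrix (i j : ℕ) (s : Finset (Fin N)) (hs : StrictMonoOn σ s)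
    (hs' : ∀ a ∈ s, (a : ℕ) < i ∧ (σ a : ℕ) < j) : s.card ≤ growth (permMatrix σ) i j 0 := by
  induction i generalizing j s with
  | zero =>
    have : s = ∅ := Finset.eq_empty_of_forall_notMem fun a ha => by simpa using (hs' a ha).1
    simp [this]
  | succ i ih =>
    induction j generalizing s with
    | zero =>
      have : s = ∅ := Finset.eq_empty_of_forall_notMem fun a ha => by simpa using (hs' a ha).2
      simp [this]
    | succ j ihj =>
      rw [growth_succ_zero]
      by_cases h1 : ∃ a ∈ s, (a : ℕ) = i
      · by_cases h2 : ∃ b ∈ s, (σ b : ℕ) = j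
        · obtain ⟨a, ha, hai⟩ := h1
          obtain ⟨b, hb, hbj⟩ := h2
          have hab : a = b := by
            rcases lt_trichotomy a b with h | h | h
            · have := (hs' b hb).1
              rw [Fin.lt_def] at h
              omega
            · exact h
            · have := (hs' a ha).2
              have := Fin.lt_def.1 (hs hb ha h)
              omega
          subst hab
          have hX : permMatrix σ i j = 1 := by
            rw [← hai, permMatrix_val, if_pos hbj]
          have h := ih (j + 1) (s.erase a) (hs.mono (by simp)) fun c hc => by
            obtain ⟨hca, hc⟩ := Finset.mem_erase.1 hc
            have := hs' c hc
            have : (c : ℕ) ≠ a := fun h => hca (Fin.ext h)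
            omega
          have := Finset.card_erase_add_one ha
          omega
        · have := ihj s hs fun b hb => by
            have := hs' b hb
            have : (σ b : ℕ) ≠ j := fun h => h2 ⟨b, hb, h⟩
            omega
          omega
      · have := ih (j + 1) s hs fun b hb => by
          have := hs' b hb
          have : (b : ℕ) ≠ i := fun h => h1 ⟨b, hb, h⟩
          omega
        omega

theorem exists_card_eq_growth_permMatrix (i j : ℕ) :
    ∃ s : Finset (Fin N), StrictMonoOn σ s ∧ (∀ a ∈ s, (a : ℕ) < i ∧ (σ a : ℕ) < j) ∧
      s.card = growth (permMatrix σ) i j 0 := by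
  induction i generalizing j with
  | zero => exact ⟨∅, by simp [StrictMonoOn], by simp, by simp [growth_zero_left]⟩
  | succ i ih =>
    induction j with
    | zero => exact ⟨∅, by simp [StrictMonoOn], by simp, by simp [growth_zero_right]⟩
    | succ j ihj =>
      obtain ⟨s, hs, hs', hcard⟩ : ∃ s : Finset (Fin N), StrictMonoOn σ s ∧
          (∀ a ∈ s, (a : ℕ) < i + 1 ∧ (σ a : ℕ) < j + 1 ∧ ((a : ℕ) < i ∨ (σ a : ℕ) < j)) ∧
          s.card = max (growth (permMatrix σ) (i + 1) j 0) (growth (permMatrix σ) i (j + 1) 0) := by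
        rcases le_total (growth (permMatrix σ) (i + 1) j 0) (growth (permMatrix σ) i (j + 1) 0)
          with h | h
        · obtain ⟨s, hs, hs', hcard⟩ := ih (j + 1)
          exact ⟨s, hs, fun a ha => by have := hs' a ha; omega, by omega⟩
        · obtain ⟨s, hs, hs', hcard⟩ := ihj
          exact ⟨s, hs, fun a ha => by have := hs' a ha; omega, by omega⟩
      rw [growth_succ_zero, ← hcard]
      rcases permMatrix_eq_zero_or σ i j with hX | ⟨hX, c, rfl, rfl⟩
      · exact ⟨s, hs, fun a ha => by have := hs' a ha; omega, by omega⟩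
      · have hlt : ∀ a ∈ s, a < c ∧ σ a < σ c := by
          intro a ha
          have h := hs' a ha
          have hne : a ≠ c := by rintro rfl; omega
          have hne' : (a : ℕ) ≠ c := fun h => hne (Fin.ext h)
          have hne'' : (σ a : ℕ) ≠ σ c := fun h => hne (σ.injective (Fin.ext h))
          rw [Fin.lt_def, Fin.lt_def]
          omega
        have hc : c ∉ s := fun h => lt_irrefl _ (hlt c h).1
        refine ⟨insert c s, ?_, ?_, by rw [Finset.card_insert_of_notMem hc, hX]⟩
        · intro a ha b hb hab
          rw [Finset.mem_coe, Finset.mem_insert] at ha hb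
          rcases ha with rfl | ha
          · rcases hb with rfl | hb
            · exact absurd hab (lt_irrefl _)
            · exact absurd hab (hlt b hb).1.le.not_gt
          · rcases hb with rfl | hb
            · exact (hlt a ha).2
            · exact hs ha hb hab
        · intro a ha
          rcases Finset.mem_insert.1 ha with rfl | ha
          · omega
          · have := hs' a ha; omega

theorem lisLen_eq_growth : lisLen σ = growth (permMatrix σ) N N 0 := by
  refine IsGreatest.csSup_eq ⟨?_, ?_⟩
  · obtain ⟨s, hs, -, hcard⟩ := exists_card_eq_growth_permMatrix σ N N
    exact ⟨s.orderEmbOfFin hcard, (s.orderEmbOfFin hcard).strictMono, fun a b hab =>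
      hs (s.orderEmbOfFin_mem hcard a) (s.orderEmbOfFin_mem hcard b)
        ((s.orderEmbOfFin hcard).strictMono hab)⟩
  · rintro m ⟨f, hf, hσf⟩
    have := card_le_growth_permMatrix σ N N (Finset.univ.map ⟨f, hf.injective⟩) (by
      intro a ha b hb hab
      simp only [Finset.coe_map, Function.Embedding.coeFn_mk, Finset.coe_univ, Set.image_univ,
        Set.mem_range] at ha hb
      obtain ⟨a, rfl⟩ := ha
      obtain ⟨b, rfl⟩ := hb
      exact hσf (hf.lt_iff_lt.1 hab)) fun a _ => ⟨a.2, (σ a).2⟩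
    simpa using this

end permMatrix

namespace YoungDiagram

theorem AddsBox.horizontalStrip {ν μ : YoungDiagram} (h : ν.AddsBox μ) :
    HorizontalStrip ν.rowLen μ.rowLen := by
  obtain ⟨i, hi⟩ := addsBox_iff_rowLen.1 h
  intro k
  have h1 := hi k
  have h2 := hi (k + 1)
  have h3 := ν.rowLen_anti k (k + 1) k.le_succ
  have h4 := μ.rowLen_anti k (k + 1) k.le_succ
  split_ifs at h1 h2 <;> omega

theorem AddsBox.sum_rowLen {ν μ : YoungDiagram} (h : ν.AddsBox μ) {K : ℕ} (hK : μ.card ≤ K) :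
    ∑ k ∈ Finset.range K, μ.rowLen k = ∑ k ∈ Finset.range K, ν.rowLen k + 1 := by
  obtain ⟨i, hi⟩ := addsBox_iff_rowLen.1 h
  have h0 : (i, 0) ∈ μ := by
    rw [mem_iff_lt_rowLen, hi, if_pos rfl]
    exact Nat.succ_pos _
  have hiK : i < K := ((mem_iff_lt_colLen.1 h0).trans_le (μ.colLen_le_card 0)).trans_le hK
  simp only [hi]
  rw [Finset.sum_add_distrib, Finset.sum_ite_eq', if_pos (Finset.mem_range.2 hiK)]

theorem addsBox_of_sum_rowLen {ν μ : YoungDiagram} (h : ∀ k, ν.rowLen k ≤ μ.rowLen k) {K : ℕ}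
    (hK : ∀ k, K ≤ k → μ.rowLen k = 0)
    (hsum : ∑ k ∈ Finset.range K, μ.rowLen k = ∑ k ∈ Finset.range K, ν.rowLen k + 1) :
    ν.AddsBox μ := by
  have h1 : ∑ k ∈ Finset.range K, (μ.rowLen k - ν.rowLen k) = 1 := by
    rw [Finset.sum_tsub_distrib _ fun k _ => h k, hsum, Nat.add_sub_cancel_left]
  obtain ⟨i, hi, hne⟩ := Finset.exists_ne_zero_of_sum_ne_zero (by rw [h1]; exact one_ne_zero)
  rw [← Finset.add_sum_erase _ _ hi] at h1
  have h0 := Finset.sum_eq_zero_iff.1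
    (show ∑ k ∈ (Finset.range K).erase i, (μ.rowLen k - ν.rowLen k) = 0 by omega)
  refine addsBox_iff_rowLen.2 ⟨i, fun k => ?_⟩
  have hk := h k
  split_ifs with hki
  · subst hki
    omega
  · by_cases hkK : k < K
    · have := h0 k (Finset.mem_erase.2 ⟨hki, Finset.mem_range.2 hkK⟩)
      omega
    · have := hK k (by omega)
      omega

theorem card_of_mem_chains {N : ℕ} {μ : YoungDiagram} {P : ℕ → YoungDiagram} (hP : P ∈ chains N μ)
    {t : ℕ} (ht : t ≤ N) : (P t).card = t := by
  obtain ⟨h0, h1, -⟩ := mem_chains.1 hP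
  induction t with
  | zero => rw [h0]; rfl
  | succ t ih => rw [(h1 t ht).card_eq, ih (by omega)]

theorem card_eq_of_mem_chains {N : ℕ} {μ : YoungDiagram} {P : ℕ → YoungDiagram}
    (hP : P ∈ chains N μ) : μ.card = N := by
  rw [← (mem_chains.1 hP).2.2 N le_rfl, card_of_mem_chains hP le_rfl]

theorem horizontalStrip_of_mem_chains {N : ℕ} {μ : YoungDiagram} {P : ℕ → YoungDiagram}
    (hP : P ∈ chains N μ) (t : ℕ) :
    HorizontalStrip (P (N - (t + 1))).rowLen (P (N - t)).rowLen := by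
  obtain ⟨h0, h1, -⟩ := mem_chains.1 hP
  by_cases ht : t < N
  · have := h1 (N - (t + 1)) (by omega)
    rw [show N - (t + 1) + 1 = N - t by omega] at this
    exact this.horizontalStrip
  · rw [show N - (t + 1) = 0 by omega, show N - t = 0 by omega, h0]
    intro k
    simp [rowLen_bot]

theorem ofRowFun_mem_chains {N : ℕ} {g : ℕ → ℕ → ℕ} (hanti : ∀ t, Antitone (g t))
    (h0 : ∀ k, g 0 k = 0) (hmono : ∀ t k, g t k ≤ g (t + 1) k)
    (hN : ∀ t ≤ N, ∀ k, N ≤ k → g t k = 0)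
    (hsum : ∀ t < N, ∑ k ∈ Finset.range (N + 1), g (t + 1) k =
      ∑ k ∈ Finset.range (N + 1), g t k + 1) :
    (fun t => ofRowFun N (g (min t N))) ∈ chains N (ofRowFun N (g N)) := by
  have hrow : ∀ t ≤ N, ∀ k, (ofRowFun N (g t)).rowLen k = g t k := fun t ht =>
    rowLen_ofRowFun (hanti t) (hN t ht)
  refine mem_chains.2 ⟨ext_rowLen fun k => ?_, fun t ht => ?_, fun t ht => ?_⟩
  · rw [Nat.zero_min, hrow 0 N.zero_le, h0, rowLen_bot]
  · rw [min_eq_left ht.le, min_eq_left (Nat.succ_le_of_lt ht)]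
    refine addsBox_of_sum_rowLen (K := N + 1) (fun k => ?_) (fun k hk => ?_) ?_
    · rw [hrow t ht.le, hrow (t + 1) ht]
      exact hmono t k
    · rw [hrow (t + 1) ht, hN (t + 1) ht k (by omega)]
    · simp only [hrow t ht.le, hrow (t + 1) ht, hsum t ht]
  · simp only [min_eq_right ht]

end YoungDiagram

open YoungDiagram

/-- The recording tableau of a permutation, as a chain of Young diagrams. -/
noncomputable def recordingChain {N : ℕ} (σ : Equiv.Perm (Fin N)) (t : ℕ) : YoungDiagram :=
  ofRowFun N (growth (permMatrix σ) (min t N) N)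

/-- The insertion tableau of a permutation, as a chain of Young diagrams. -/
noncomputable def insertionChain {N : ℕ} (σ : Equiv.Perm (Fin N)) (t : ℕ) : YoungDiagram :=
  ofRowFun N (growth (permMatrix σ) N (min t N))

section

variable {N : ℕ} (σ : Equiv.Perm (Fin N))

theorem rowLen_recordingChain (t k : ℕ) :
    (recordingChain σ t).rowLen k = growth (permMatrix σ) (min t N) N k :=
  rowLen_ofRowFun (growth_antitone _ _ _)
    (fun _ hk => growth_eq_zero_of_le _ ((min_le_right t N).trans hk)) k

theorem rowLen_insertionChain (t k : ℕ) :
    (insertionChain σ t).rowLen k = growth (permMatrix σ) N (min t N) k :=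
  rowLen_ofRowFun (growth_antitone _ _ _) (fun _ hk => growth_eq_zero_of_le _ hk) k

theorem recordingChain_mem_chains :
    recordingChain σ ∈ chains N (ofRowFun N (growth (permMatrix σ) N N)) := by
  refine ofRowFun_mem_chains (g := fun t => growth (permMatrix σ) t N)
    (fun t => growth_antitone _ _ _) (fun k => growth_zero_left _ _ _)
    (fun t k => growth_le_succ_left _ _ _ _)
    (fun t ht k hk => growth_eq_zero_of_le _ (ht.trans hk)) fun t ht => ?_
  rw [sum_growth_succ_left _ _ _ _ ht.le, sum_permMatrix_row σ ht]

theorem insertionChain_mem_chains :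
    insertionChain σ ∈ chains N (ofRowFun N (growth (permMatrix σ) N N)) := by
  refine ofRowFun_mem_chains (g := fun t => growth (permMatrix σ) N t)
    (fun t => growth_antitone _ _ _) (fun k => growth_zero_right _ _ _)
    (fun t k => growth_le_succ_right _ _ _ _)
    (fun t ht k hk => growth_eq_zero_of_le _ hk) fun t ht => ?_
  rw [sum_growth_succ_right _ _ _ _ N.le_succ, sum_permMatrix_col σ ht]

theorem exists_recordingChain_eq {μ : YoungDiagram} {P Q : ℕ → YoungDiagram} (hP : P ∈ chains N μ)
    (hQ : Q ∈ chains N μ) :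
    ∃ σ : Equiv.Perm (Fin N), recordingChain σ = P ∧ insertionChain σ = Q := by
  obtain ⟨hP0, hP1, hP2⟩ := mem_chains.1 hP
  obtain ⟨hQ0, hQ1, hQ2⟩ := mem_chains.1 hQ
  obtain ⟨X, hXQ, hXP⟩ := exists_growth_eq (N := N) (p := fun b => (Q (N - b)).rowLen)
    (q := fun a => (P (N - a)).rowLen) (by simp only [Nat.sub_zero, hP2 N le_rfl, hQ2 N le_rfl])
    (horizontalStrip_of_mem_chains hQ) (horizontalStrip_of_mem_chains hP)
    (fun k => by simp only [Nat.sub_self, hQ0, rowLen_bot])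
    (fun k => by simp only [Nat.sub_self, hP0, rowLen_bot])
  have hXQ' : ∀ t ≤ N, ∀ k, growth X N t k = (Q t).rowLen k := fun t ht k => by
    have := hXQ (N - t) (by omega) k
    rwa [Nat.sub_sub_self ht] at this
  have hXP' : ∀ t ≤ N, ∀ k, growth X t N k = (P t).rowLen k := fun t ht k => by
    have := hXP (N - t) (by omega) k
    rwa [Nat.sub_sub_self ht] at this
  obtain ⟨σ, hσ⟩ := exists_permMatrix_eq (N := N) (X := X)
    (fun i hi => by
      have h := sum_growth_succ_left X i N N hi.le
      simp only [hXP' i hi.le, hXP' (i + 1) hi] at h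
      rw [(hP1 i hi).sum_rowLen (by rw [card_of_mem_chains hP hi]; omega)] at h
      omega)
    (fun j hj => by
      have h := sum_growth_succ_right X N j N N.le_succ
      simp only [hXQ' j hj.le, hXQ' (j + 1) hj] at h
      rw [(hQ1 j hj).sum_rowLen (by rw [card_of_mem_chains hQ hj]; omega)] at h
      omega)
  refine ⟨σ, funext fun t => ext_rowLen fun k => ?_, funext fun t => ext_rowLen fun k => ?_⟩
  · rw [rowLen_recordingChain, ← growth_congr hσ _ (min_le_right t N) _ le_rfl,
      hXP' _ (min_le_right t N)]
    rcases le_total t N with h | h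
    · rw [min_eq_left h]
    · rw [min_eq_right h, hP2 t h, hP2 N le_rfl]
  · rw [rowLen_insertionChain, ← growth_congr hσ _ le_rfl _ (min_le_right t N),
      hXQ' _ (min_le_right t N)]
    rcases le_total t N with h | h
    · rw [min_eq_left h]
    · rw [min_eq_right h, hQ2 t h, hQ2 N le_rfl]

theorem eq_of_recordingChain_eq {σ τ : Equiv.Perm (Fin N)}
    (h1 : recordingChain σ = recordingChain τ) (h2 : insertionChain σ = insertionChain τ) :
    σ = τ := by
  refine permMatrix_injective (eq_of_growth_boundary_eq (fun j hj k => ?_) fun i hi k => ?_)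
  · have := congrArg (fun R => (R j).rowLen k) h2
    simpa only [rowLen_insertionChain, min_eq_left hj] using this
  · have := congrArg (fun R => (R i).rowLen k) h1
    simpa only [rowLen_recordingChain, min_eq_left hi] using this

end

/-- The Robinson–Schensted correspondence, restricted to shapes with bounded first row. -/
theorem card_lisLen_le (N n : ℕ) :
    (Finset.univ.filter fun σ : Equiv.Perm (Fin N) => lisLen σ ≤ n).card =
      ∑ μ ∈ (ofCard N).filter (rowLen · 0 ≤ n), (chains N μ).card ^ 2 := by
  have hrow : ∀ σ : Equiv.Perm (Fin N),
      (ofRowFun N (growth (permMatrix σ) N N)).rowLen 0 = lisLen σ := fun σ => by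
    rw [lisLen_eq_growth, rowLen_ofRowFun (growth_antitone _ _ _)
      (fun _ hk => growth_eq_zero_of_le _ hk)]
  have : ∀ μ, (chains N μ).card ^ 2 = (chains N μ ×ˢ chains N μ).card := fun μ => by
    rw [Finset.card_product, sq]
  simp only [this]
  rw [← Finset.card_sigma]
  refine Finset.card_bij (fun σ _ =>
    ⟨ofRowFun N (growth (permMatrix σ) N N), recordingChain σ, insertionChain σ⟩) ?_ ?_ ?_
  · intro σ hσ
    rw [Finset.mem_sigma, Finset.mem_filter, mem_ofCard, Finset.mem_product]
    refine ⟨⟨card_eq_of_mem_chains (recordingChain_mem_chains σ), ?_⟩,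
      recordingChain_mem_chains σ, insertionChain_mem_chains σ⟩
    rw [hrow]
    exact (Finset.mem_filter.1 hσ).2
  · intro σ _ τ _ h
    simp only [Sigma.mk.injEq, heq_eq_eq, Prod.mk.injEq] at h
    exact eq_of_recordingChain_eq h.2.1 h.2.2
  · rintro ⟨μ, P, Q⟩ h
    rw [Finset.mem_sigma, Finset.mem_filter, Finset.mem_product] at h
    obtain ⟨⟨-, hμ⟩, hP, hQ⟩ := h
    obtain ⟨σ, rfl, rfl⟩ := exists_recordingChain_eq hP hQ
    have hσ : ofRowFun N (growth (permMatrix σ) N N) = μ := by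
      have h : ofRowFun N (growth (permMatrix σ) (min N N) N) = μ := (mem_chains.1 hP).2.2 N le_rfl
      rwa [min_self] at h
    refine ⟨σ, Finset.mem_filter.2 ⟨Finset.mem_univ _, ?_⟩, ?_⟩
    · rw [← hrow, hσ]
      exact hμ
    · rw [hσ]

theorem YoungDiagram.rowLen_eq_zero_iff_rowLen_transpose_le (μ : YoungDiagram) (n : ℕ) :
    μ.rowLen n = 0 ↔ μ.transpose.rowLen 0 ≤ n := by
  rw [rowLen_transpose, ← not_lt, ← mem_iff_lt_colLen, mem_iff_lt_rowLen, Nat.pos_iff_ne_zero,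
    not_not]

theorem card_lisLen_le_eq_sum_rowLen_eq_zero (N n : ℕ) :
    (Finset.univ.filter fun σ : Equiv.Perm (Fin N) => lisLen σ ≤ n).card =
      ∑ μ ∈ (ofCard N).filter (rowLen · n = 0), (chains N μ).card ^ 2 := by
  rw [card_lisLen_le]
  refine Finset.sum_nbij' transpose transpose (fun μ hμ => ?_) (fun μ hμ => ?_)
    (fun μ _ => transpose_transpose μ) (fun μ _ => transpose_transpose μ)
    fun μ _ => by rw [card_chains_transpose]
  · rw [Finset.mem_filter, mem_ofCard] at hμ ⊢
    rwa [card_transpose, rowLen_eq_zero_iff_rowLen_transpose_le, transpose_transpose]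
  · rw [Finset.mem_filter, mem_ofCard] at hμ ⊢
    rwa [card_transpose, ← rowLen_eq_zero_iff_rowLen_transpose_le]

/-- Gessel's formula, Poissonized version:
`∑_N e^{-α} α^N / N! · P[ℓ_N ≤ n] = e^{-α} D_n(e^{2√α cos θ})`, where `D_n` is the
`n × n` Toeplitz determinant with symbol `exp(2√α cos θ)`. -/
theorem poissonized_gessel (n : ℕ) (hn : 1 ≤ n) (α : ℝ) (hα : 0 < α) :
    ((∑' N : ℕ, Real.exp (-α) * α ^ N / Nat.factorial N * lisFrac N n : ℝ) : ℂ) =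
      Real.exp (-α) *
        Matrix.det fun i j : Fin n =>
          (1 / (2 * π) : ℂ) *
            ∫ θ in (-π)..π,
              Real.exp (2 * Real.sqrt α * Real.cos θ) *
                Complex.exp (-(((i : ℤ) - (j : ℤ)) : ℤ) * θ * Complex.I) := by
  have hdet : (Matrix.det fun i j : Fin n =>
      (1 / (2 * π) : ℂ) *
        ∫ θ in (-π)..π,
          Real.exp (2 * Real.sqrt α * Real.cos θ) *
            Complex.exp (-(((i : ℤ) - (j : ℤ)) : ℤ) * θ * Complex.I)) =
      expCosDet (Real.sqrt α) (shifted n ⊥) := by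
    rw [expCosDet, ← Matrix.det_transpose]
    congr 1
    ext i j
    rw [Matrix.transpose_apply, Matrix.of_apply, expCosCoeff, shifted, rowLen_bot]
    push_cast
    congr! 7
    ring
  have hsum := hasSum_expCosDet n (Real.sqrt α)
  rw [hdet, ← hsum.tsum_eq, ← tsum_mul_left, Complex.ofReal_tsum]
  refine tsum_congr fun N => ?_
  have hpow : (Real.sqrt α : ℂ) ^ (2 * N) = (α : ℂ) ^ N := by
    rw [pow_mul, ← Complex.ofReal_pow, Real.sq_sqrt hα.le]
  have hcard := congrArg (Nat.cast : ℕ → ℂ) (card_lisLen_le_eq_sum_rowLen_eq_zero N n)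
  push_cast at hcard
  rw [hpow, ← hcard, lisFrac]
  push_cast
  ring
end
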